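/- Let (u, b, p) be a smooth bounded solution of the stationary MHD/Hall–MHD system with parameter δ ∈ [0,1] on the slab ℝ²×𝕋, and suppose there exist constants C > 0 and α > 0 such that ∫_{{|x'| ≤ R}×[0,1]} (|∇u|² + |∇b|²) dx ≤ C R^α for all R > 1. If the radial components u^r and b^r are axisymmetric, then there are constants c₁, c₂ ∈ ℝ with u ≡ (0, 0, c₁) and b ≡ (0, 0, c₂). -/

import Mathlib

open MeasureTheory

noncomputable section

/-- Points of `ℝ³`. -/
abbrev V3 : Type := Fin 3 → ℝ

/-- Partial derivative `∂ᵢ f`. -/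
def pd (i : Fin 3) (f : V3 → ℝ) (x : V3) : ℝ := fderiv ℝ f x (Pi.single i 1)

/-- Componentwise Laplacian. -/
def lap (f : V3 → ℝ) (x : V3) : ℝ := ∑ i, pd i (pd i f) x

/-- Cross product in `ℝ³`. -/
def cross3 (a c : V3) : V3 :=
  ![a 1 * c 2 - a 2 * c 1, a 2 * c 0 - a 0 * c 2, a 0 * c 1 - a 1 * c 0]

/-- Curl of a vector field. -/
def curl (b : V3 → V3) (x : V3) : V3 :=
  ![pd 1 (fun y => b y 2) x - pd 2 (fun y => b y 1) x,
    pd 2 (fun y => b y 0) x - pd 0 (fun y => b y 2) x,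
    pd 0 (fun y => b y 1) x - pd 1 (fun y => b y 0) x]

/-- Euclidean dot product in `ℝ³`. -/
def dot3 (a c : V3) : ℝ := ∑ i, a i * c i

/-- `|x'| = √(x₁² + x₂²)`. -/
def nr (x : V3) : ℝ := Real.sqrt ((x 0) ^ 2 + (x 1) ^ 2)

/-- The slab `ℝ² × [0,1]`. -/
def slab : Set V3 := {x | 0 ≤ x 2 ∧ x 2 ≤ 1}

/-- The region `{|x'| ≤ R} × [0,1]`. -/
def cylSet (R : ℝ) : Set V3 := {x | (0 ≤ x 2 ∧ x 2 ≤ 1) ∧ nr x ≤ R}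

/-- The annular region `O_R = {R-1 ≤ |x'| ≤ R} × [0,1]`. -/
def OR (R : ℝ) : Set V3 := {x | (0 ≤ x 2 ∧ x 2 ≤ 1) ∧ R - 1 ≤ nr x ∧ nr x ≤ R}

/-- The radial cut-off function `φ_R`. -/
def phiR (R : ℝ) (x : V3) : ℝ := min 1 (max 0 (R - nr x))

/-- `|∇u|² = Σ_{i,j} |∂ᵢ uʲ|²`. -/
def gradSq (u : V3 → V3) (x : V3) : ℝ := ∑ i, ∑ j, (pd i (fun y => u y j) x) ^ 2

/-- The `L²` norm of a scalar function on a set. -/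
def l2 (f : V3 → ℝ) (S : Set V3) : ℝ := Real.sqrt (∫ x in S, (f x) ^ 2)

/-- The radial component `u^r` as a function of `x`. -/
def ur (u : V3 → V3) (x : V3) : ℝ := (x 0 * u x 0 + x 1 * u x 1) / nr x

/-- The point with cylindrical coordinates `(r, θ, z)`. -/
def cylPt (r θ z : ℝ) : V3 := ![r * Real.cos θ, r * Real.sin θ, z]

/-- The radial component `u^r` in cylindrical coordinates. -/
def compR (u : V3 → V3) (r θ z : ℝ) : ℝ :=
  Real.cos θ * u (cylPt r θ z) 0 + Real.sin θ * u (cylPt r θ z) 1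

/-- The swirl component `u^θ` in cylindrical coordinates. -/
def compTheta (u : V3 → V3) (r θ z : ℝ) : ℝ :=
  -Real.sin θ * u (cylPt r θ z) 0 + Real.cos θ * u (cylPt r θ z) 1

/-- A cylindrical component is axisymmetric if it is independent of `θ`. -/
def AxiSym (f : ℝ → ℝ → ℝ → ℝ) : Prop := ∀ r θ₁ θ₂ z, f r θ₁ z = f r θ₂ z

/-- `1`-periodicity in the `x₃` variable. -/
def PeriodicZ (u : V3 → V3) : Prop := ∀ x : V3, u ![x 0, x 1, x 2 + 1] = u x

/-- Divergence-free vector field. -/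
def DivFree (u : V3 → V3) : Prop := ∀ x, ∑ i, pd i (fun y => u y i) x = 0

/-- Boundedness of a vector field. -/
def Bounded3 (u : V3 → V3) : Prop := ∃ M, ∀ x, ‖u x‖ ≤ M

/-- The stationary MHD (`δ = 0`) / Hall–MHD (`δ = 1`) system:
`(u·∇)u + ∇p − (b·∇)b − Δu = 0`,
`(u·∇)b − (b·∇)u − Δb = δ ∇×((∇×b)×b)`, `div u = div b = 0`. -/
def IsMHD (δ : ℝ) (u b : V3 → V3) (p : V3 → ℝ) : Prop :=
  (∀ x i, (∑ j, u x j * pd j (fun y => u y i) x) + pd i p x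
      - (∑ j, b x j * pd j (fun y => b y i) x) - lap (fun y => u y i) x = 0) ∧
  (∀ x i, (∑ j, u x j * pd j (fun y => b y i) x)
      - (∑ j, b x j * pd j (fun y => u y i) x) - lap (fun y => b y i) x
      = δ * curl (fun y => cross3 (curl b y) (b y)) x i) ∧
  DivFree u ∧ DivFree b

/-- Growth of the local Dirichlet integral: `∫_{{|x'|≤R}×[0,1]} |∇u|²+|∇b|² ≤ C R^α`. -/
def DirichletGrowth (u b : V3 → V3) : Prop :=
  ∃ C > (0:ℝ), ∃ α > (0:ℝ), ∀ R > (1:ℝ),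
    (∫ x in cylSet R, (gradSq u x + gradSq b x)) ≤ C * R ^ α

/-- Radial derivative `∂_r f = (x'/|x'|)·(∂₁f, ∂₂f)`. -/
def radD (f : V3 → ℝ) (x : V3) : ℝ := (x 0 / nr x) * pd 0 f x + (x 1 / nr x) * pd 1 f x

/-- The unit radial vector `(x'/|x'|, 0)`. -/
def er3 (x : V3) : V3 := ![x 0 / nr x, x 1 / nr x, 0]

/-- Squared Euclidean length of a vector of `ℝ³`. -/
def sq3 (v : V3) : ℝ := ∑ i, (v i) ^ 2

section Calculus

open Set Filter Topology
open scoped ContDiff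

theorem contDiff_pd {f : V3 → ℝ} (hf : ContDiff ℝ ∞ f) (i : Fin 3) : ContDiff ℝ ∞ (pd i f) := by
  unfold pd
  exact (hf.fderiv_right (m := ∞) (by simp)).clm_apply contDiff_const

theorem continuous_pd {f : V3 → ℝ} (hf : ContDiff ℝ 1 f) (i : Fin 3) : Continuous (pd i f) := by
  unfold pd
  exact (hf.continuous_fderiv (by simp)).clm_apply continuous_const

theorem pd_add {f g : V3 → ℝ} (hf : Differentiable ℝ f) (hg : Differentiable ℝ g) (i : Fin 3)
    (x : V3) : pd i (fun y => f y + g y) x = pd i f x + pd i g x := by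
  simp [pd, fderiv_fun_add (hf x) (hg x)]

theorem pd_sub {f g : V3 → ℝ} (hf : Differentiable ℝ f) (hg : Differentiable ℝ g) (i : Fin 3)
    (x : V3) : pd i (fun y => f y - g y) x = pd i f x - pd i g x := by
  simp [pd, fderiv_fun_sub (hf x) (hg x)]

theorem pd_mul {f g : V3 → ℝ} (hf : Differentiable ℝ f) (hg : Differentiable ℝ g) (i : Fin 3)
    (x : V3) : pd i (fun y => f y * g y) x = f x * pd i g x + g x * pd i f x := by
  simp [pd, fderiv_fun_mul (hf x) (hg x)]

theorem pd_const_mul {f : V3 → ℝ} (hf : Differentiable ℝ f) (c : ℝ) (i : Fin 3)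
    (x : V3) : pd i (fun y => c * f y) x = c * pd i f x := by
  simp [pd, fderiv_const_mul (hf x)]

theorem pd_coord (i j : Fin 3) (x : V3) : pd i (fun y => y j) x = if i = j then 1 else 0 := by
  have : HasFDerivAt (fun y : V3 => y j) (ContinuousLinearMap.proj (R := ℝ) j) x :=
    (ContinuousLinearMap.proj (R := ℝ) (φ := fun _ : Fin 3 => ℝ) j).hasFDerivAt
  simp [pd, this.fderiv, Pi.single_apply, eq_comm]

/-- The function vanishes for large `|x'|`. -/
def HorizCompact (f : V3 → ℝ) : Prop :=
  ∃ L, ∀ x : V3, L ≤ |x 0| ∨ L ≤ |x 1| → f x = 0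

theorem HorizCompact.mul_right {f : V3 → ℝ} (hf : HorizCompact f) (g : V3 → ℝ) :
    HorizCompact (fun x => f x * g x) := by
  obtain ⟨L, hL⟩ := hf
  exact ⟨L, fun x hx => by simp [hL x hx]⟩

theorem HorizCompact.add {f g : V3 → ℝ} (hf : HorizCompact f) (hg : HorizCompact g) :
    HorizCompact (fun x => f x + g x) := by
  obtain ⟨L, hL⟩ := hf
  obtain ⟨L', hL'⟩ := hg
  refine ⟨max L L', fun x hx => ?_⟩
  show f x + g x = 0
  rw [hL x, hL' x, add_zero]
  · exact hx.imp (le_trans (le_max_right _ _)) (le_trans (le_max_right _ _))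
  · exact hx.imp (le_trans (le_max_left _ _)) (le_trans (le_max_left _ _))

theorem HorizCompact.pd {f : V3 → ℝ} (hf : HorizCompact f) (i : Fin 3) :
    HorizCompact (pd i f) := by
  obtain ⟨L, hL⟩ := hf
  refine ⟨L + 1, fun x hx => ?_⟩
  have h : f =ᶠ[𝓝 x] fun _ => 0 := by
    have h1 : ∀ᶠ y : V3 in 𝓝 x, L < |y 0| ∨ L < |y 1| := by
      rcases hx with hx | hx
      · have : Tendsto (fun y : V3 => |y 0|) (𝓝 x) (𝓝 |x 0|) :=
          Continuous.tendsto (by fun_prop) x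
        filter_upwards [this.eventually (lt_mem_nhds (by linarith : L < |x 0|))] with y hy
        exact Or.inl hy
      · have : Tendsto (fun y : V3 => |y 1|) (𝓝 x) (𝓝 |x 1|) :=
          Continuous.tendsto (by fun_prop) x
        filter_upwards [this.eventually (lt_mem_nhds (by linarith : L < |x 1|))] with y hy
        exact Or.inr hy
    filter_upwards [h1] with y hy
    exact hL y (hy.imp le_of_lt le_of_lt)
  simp [_root_.pd, h.fderiv_eq]

theorem measurableSet_slab : MeasurableSet slab :=
  (measurableSet_le measurable_const (measurable_pi_apply 2)).inter
    (measurableSet_le (measurable_pi_apply 2) measurable_const)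

/-- The box `[-L, L]² × [0, 1]`. -/
def box (L : ℝ) : Set V3 := Icc ![-L, -L, 0] ![L, L, 1]

theorem mem_box {L : ℝ} {x : V3} : x ∈ box L ↔ |x 0| ≤ L ∧ |x 1| ≤ L ∧ x ∈ slab := by
  simp only [box, mem_Icc, Pi.le_def, Fin.forall_fin_succ, abs_le, slab, mem_ofPred_eq]
  simp
  tauto

theorem setIntegral_slab_eq_box {f : V3 → ℝ} {L : ℝ}
    (hf : ∀ x : V3, L ≤ |x 0| ∨ L ≤ |x 1| → f x = 0) :
    ∫ x in slab, f x = ∫ x in box L, f x := by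
  refine setIntegral_eq_of_subset_of_forall_sdiff_eq_zero measurableSet_slab
    (fun x hx => (mem_box.1 hx).2.2) fun x hx => hf x ?_
  by_contra! h
  exact hx.2 (mem_box.2 ⟨h.1.le, h.2.le, hx.1⟩)

theorem HorizCompact.integrableOn {f : V3 → ℝ} (hf : HorizCompact f) (hc : Continuous f) :
    IntegrableOn f slab := by
  obtain ⟨L, hL⟩ := hf
  have h1 : IntegrableOn f (box L) := hc.continuousOn.integrableOn_compact isCompact_Icc
  refine h1.of_forall_sdiff_eq_zero measurableSet_slab fun x hx => hL x ?_
  by_contra! h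
  exact hx.2 (mem_box.2 ⟨h.1.le, h.2.le, hx.1⟩)

/-- Divergence theorem on the slab. -/
theorem integral_slab_div_eq_zero {F : Fin 3 → V3 → ℝ} (hF : ∀ i, ContDiff ℝ 1 (F i))
    (hc : ∀ i, HorizCompact (F i)) (hper : ∀ x y, F 2 ![x, y, 1] = F 2 ![x, y, 0]) :
    ∫ x in slab, ∑ i, pd i (F i) x = 0 := by
  have h1 : ∃ L, 0 ≤ L ∧ ∀ x : V3, L ≤ |x 0| ∨ L ≤ |x 1| →
      (∀ i, F i x = 0) ∧ (∀ i, pd i (F i) x = 0) := by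
    choose L hL using hc
    choose L' hL' using fun i => HorizCompact.pd ⟨L i, hL i⟩ i
    refine ⟨∑ i, (|L i| + |L' i|), by positivity, fun x hx => ?_⟩
    have h2 : ∀ i, L i ≤ ∑ i, (|L i| + |L' i|) ∧ L' i ≤ ∑ i, (|L i| + |L' i|) := fun i => by
      have := Finset.single_le_sum (f := fun i => |L i| + |L' i|) (fun i _ => by positivity)
        (Finset.mem_univ i)
      have h3 := le_abs_self (L i)
      have h4 := le_abs_self (L' i)
      have h5 := abs_nonneg (L i)
      have h6 := abs_nonneg (L' i)
      constructor <;> linarith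
    exact ⟨fun i => hL i x (hx.imp (h2 i).1.trans (h2 i).1.trans),
      fun i => hL' i x (hx.imp (h2 i).2.trans (h2 i).2.trans)⟩
  obtain ⟨L, hL0, hL⟩ := h1
  rw [setIntegral_slab_eq_box (L := L) fun x hx => by simp [(hL x hx).2]]
  have hle : (![-L, -L, 0] : V3) ≤ ![L, L, 1] := by
    intro i
    fin_cases i <;> simp <;> linarith
  have := integral_divergence_of_hasFDerivAt_off_countable' ![-L, -L, 0] ![L, L, 1] hle F
    (fun i => fderiv ℝ (F i)) ∅ countable_empty (fun i => (hF i).continuous.continuousOn)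
    (fun x _ i => ((hF i).differentiable (by simp) x).hasFDerivAt)
    ((continuous_finsetSum _ fun i _ => continuous_pd (hF i) i).continuousOn.integrableOn_compact
      isCompact_Icc)
  refine this.trans ?_
  have z : ∀ (i : Fin 3) (c : ℝ), i ≠ 2 → |c| = L → ∀ y : Fin 2 → ℝ,
      F i (i.insertNth c y) = 0 := by
    intro i c hi hcL y
    refine (hL _ ?_).1 i
    have : |(i.insertNth c y : V3) i| = L := by simp [hcL]
    fin_cases i
    · exact Or.inl this.ge
    · exact Or.inr this.ge
    · exact absurd rfl hi
  have z2 : ∀ y : Fin 2 → ℝ, F 2 ((2 : Fin 3).insertNth (1 : ℝ) y) =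
      F 2 ((2 : Fin 3).insertNth (0 : ℝ) y) := by
    intro y
    have h : ∀ c : ℝ, ((2 : Fin 3).insertNth c y : V3) = ![y 0, y 1, c] := by
      intro c
      ext j
      fin_cases j
      · exact Fin.insertNth_apply_succAbove (α := fun _ => ℝ) (2 : Fin 3) c y 0
      · exact Fin.insertNth_apply_succAbove (α := fun _ => ℝ) (2 : Fin 3) c y 1
      · exact Fin.insertNth_apply_same (α := fun _ => ℝ) (2 : Fin 3) c y
    rw [h, h, hper]
  rw [Fin.sum_univ_three]
  have e0 : ∀ y, F 0 ((0 : Fin 3).insertNth ((![L, L, 1] : V3) 0) y) = 0 :=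
    z 0 _ (by decide) (abs_of_nonneg hL0)
  have e0' : ∀ y, F 0 ((0 : Fin 3).insertNth ((![-L, -L, 0] : V3) 0) y) = 0 :=
    z 0 _ (by decide) (by simp [abs_of_nonneg hL0])
  have e1 : ∀ y, F 1 ((1 : Fin 3).insertNth ((![L, L, 1] : V3) 1) y) = 0 :=
    z 1 _ (by decide) (abs_of_nonneg hL0)
  have e1' : ∀ y, F 1 ((1 : Fin 3).insertNth ((![-L, -L, 0] : V3) 1) y) = 0 :=
    z 1 _ (by decide) (by simp [abs_of_nonneg hL0])
  have e2 : ∀ y, F 2 ((2 : Fin 3).insertNth ((![L, L, 1] : V3) 2) y) =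
      F 2 ((2 : Fin 3).insertNth ((![-L, -L, 0] : V3) 2) y) := z2
  simp only [Nat.reduceAdd, Nat.succ_eq_add_one, e0, e0', e1, e1', e2, integral_zero, sub_self,
    add_zero]

end Calculus

section VerticalAverage

open Set Filter Topology
open scoped ContDiff

/-- Vertical average over `[0, 1]`. -/
def vavg (f : V3 → ℝ) (x : V3) : ℝ := ∫ s in (0 : ℝ)..1, f ![x 0, x 1, s]

theorem continuous_mk3 {X : Type*} [TopologicalSpace X] {a b c : X → ℝ} (ha : Continuous a)
    (hb : Continuous b) (hc : Continuous c) : Continuous fun x => (![a x, b x, c x] : V3) := by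
  refine continuous_pi fun i => ?_
  fin_cases i <;> simpa

theorem vec3_eta (x : V3) : ![x 0, x 1, x 2] = x := by
  ext i
  fin_cases i <;> rfl

theorem continuous_column {f : V3 → ℝ} (hf : Continuous f) (a b : ℝ) :
    Continuous fun s => f ![a, b, s] :=
  hf.comp (continuous_mk3 continuous_const continuous_const continuous_id)

theorem continuous_vavg {f : V3 → ℝ} (hf : Continuous f) : Continuous (vavg f) := by
  unfold vavg
  refine intervalIntegral.continuous_parametric_intervalIntegral_of_continuous'
    (f := fun (x : V3) s => f ![x 0, x 1, s]) ?_ 0 1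
  exact hf.comp (continuous_mk3 (by fun_prop) (by fun_prop) (by fun_prop))

theorem vavg_vavg (f : V3 → ℝ) (x : V3) : vavg (vavg f) x = vavg f x := by
  simp [vavg]

theorem vavg_mono {f g : V3 → ℝ} (hf : Continuous f) (hg : Continuous g)
    (h : ∀ x, f x ≤ g x) (x : V3) : vavg f x ≤ vavg g x :=
  intervalIntegral.integral_mono_on (by norm_num)
    ((continuous_column hf _ _).intervalIntegrable _ _)
    ((continuous_column hg _ _).intervalIntegrable _ _) fun s _ => h _

theorem vavg_nonneg {f : V3 → ℝ} (h : ∀ x, 0 ≤ f x) (x : V3) : 0 ≤ vavg f x :=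
  intervalIntegral.integral_nonneg (by norm_num) fun s _ => h _

theorem HorizCompact.vavg {f : V3 → ℝ} (hf : HorizCompact f) : HorizCompact (vavg f) := by
  obtain ⟨L, hL⟩ := hf
  refine ⟨L, fun x hx => ?_⟩
  unfold _root_.vavg
  simp [fun s => hL ![x 0, x 1, s] hx]

theorem integral_slab_eq_integral_vavg {f : V3 → ℝ} (hf : Continuous f) (hc : HorizCompact f) :
    ∫ x in slab, f x = ∫ y : Fin 2 → ℝ, vavg f ![y 0, y 1, 0] := by
  let e := MeasurableEquiv.piFinSuccAbove (fun _ : Fin 3 => ℝ) 2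
  have he : MeasurePreserving e volume volume :=
    volume_preserving_piFinSuccAbove (fun _ : Fin 3 => ℝ) 2
  have hs : slab = e ⁻¹' (Icc 0 1 ×ˢ univ) := by
    ext x
    simp [slab, e, MeasurableEquiv.piFinSuccAbove, Fin.insertNthEquiv]
  have hsymm : ∀ z (y : Fin 2 → ℝ), e.symm (z, y) = ![y 0, y 1, z] := by
    intro z y
    ext j
    fin_cases j
    · exact Fin.insertNth_apply_succAbove (α := fun _ => ℝ) (2 : Fin 3) z y 0
    · exact Fin.insertNth_apply_succAbove (α := fun _ => ℝ) (2 : Fin 3) z y 1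
    · exact Fin.insertNth_apply_same (α := fun _ => ℝ) (2 : Fin 3) z y
  have h1 := he.setIntegral_preimage_emb e.measurableEmbedding (fun q => f (e.symm q))
    (Icc 0 1 ×ˢ univ)
  have hi : IntegrableOn (fun q => f (e.symm q)) (Icc 0 1 ×ˢ univ) := by
    rw [← he.integrableOn_comp_preimage e.measurableEmbedding, ← hs]
    convert hc.integrableOn hf using 1
    ext x
    simp
  rw [← hs] at h1
  simp only [MeasurableEquiv.symm_apply_apply] at h1
  rw [h1]
  rw [IntegrableOn, Measure.volume_eq_prod, ← Measure.prod_restrict, Measure.restrict_univ] at hi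
  rw [Measure.volume_eq_prod, ← Measure.prod_restrict, Measure.restrict_univ,
    integral_prod_symm _ hi]
  congr 1
  ext y
  rw [vavg, intervalIntegral.integral_of_le (by norm_num), integral_Icc_eq_integral_Ioc]
  simp [hsymm]

theorem integral_slab_vavg {f : V3 → ℝ} (hf : Continuous f) (hc : HorizCompact f) :
    ∫ x in slab, vavg f x = ∫ x in slab, f x := by
  rw [integral_slab_eq_integral_vavg hf hc,
    integral_slab_eq_integral_vavg (continuous_vavg hf) hc.vavg]
  simp only [vavg_vavg]

theorem hasDerivAt_line {f : V3 → ℝ} (hf : Differentiable ℝ f) (i : Fin 3) (x : V3) :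
    HasDerivAt (fun h : ℝ => f (x + h • Pi.single i 1)) (pd i f x) 0 :=
  (hf x).hasFDerivAt.hasLineDerivAt _

theorem hasDerivAt_column {f : V3 → ℝ} (hf : Differentiable ℝ f) (a b s : ℝ) :
    HasDerivAt (fun s => f ![a, b, s]) (pd 2 f ![a, b, s]) s := by
  have h := hasDerivAt_line hf 2 ![a, b, s]
  have h2 := HasDerivAt.comp_sub_const (f := fun h : ℝ => f (![a, b, s] + h • Pi.single 2 1)) s s
    (by simpa using h)
  have e : (fun s => f ![a, b, s]) = fun r => f (![a, b, s] + (r - s) • Pi.single 2 1) := by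
    ext r
    refine congrArg f (funext fun i => ?_)
    fin_cases i <;> simp
  rw [e]
  exact h2

theorem abs_integral_le_unit {f : ℝ → ℝ} (hf : Continuous f) {a b : ℝ} (ha : a ∈ Icc (0 : ℝ) 1)
    (hb : b ∈ Icc (0 : ℝ) 1) : |∫ s in a..b, f s| ≤ ∫ s in (0 : ℝ)..1, |f s| := by
  refine (intervalIntegral.norm_integral_le_integral_norm_uIoc (f := f) (μ := volume)).trans ?_
  rw [intervalIntegral.integral_of_le (by norm_num)]
  refine setIntegral_mono_set ?_ (ae_of_all _ fun s => norm_nonneg _) (LE.le.eventuallyLE ?_)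
  · exact ((hf.abs).intervalIntegrable 0 1).1
  · intro s hs
    rw [uIoc] at hs
    exact ⟨(le_min ha.1 hb.1).trans_lt hs.1, hs.2.trans (max_le ha.2 hb.2)⟩

/-- Vertical Poincaré inequality for functions of zero vertical mean. -/
theorem abs_le_vavg_pd {m : V3 → ℝ} (hm : ContDiff ℝ 1 m) {x : V3} (h0 : vavg m x = 0)
    (hx : x ∈ slab) : |m x| ≤ vavg (fun y => |pd 2 m y|) x := by
  have hc := continuous_column hm.continuous (x 0) (x 1)
  have hc' := continuous_column (continuous_pd hm 2) (x 0) (x 1)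
  have h1 : m x = ∫ s in (0 : ℝ)..1, (m ![x 0, x 1, x 2] - m ![x 0, x 1, s]) := by
    rw [intervalIntegral.integral_sub (by simp) (hc.intervalIntegrable _ _)]
    unfold vavg at h0
    rw [h0, vec3_eta]
    simp
  have h2 := intervalIntegral.norm_integral_le_of_norm_le_const
    (f := fun s => m ![x 0, x 1, x 2] - m ![x 0, x 1, s]) (a := 0) (b := 1)
    (C := vavg (fun y => |pd 2 m y|) x) (by
      intro s hs
      rw [uIoc_of_le (by norm_num)] at hs
      have h3 : ∫ t in s..(x 2), pd 2 m ![x 0, x 1, t] =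
          m ![x 0, x 1, x 2] - m ![x 0, x 1, s] :=
        intervalIntegral.integral_eq_sub_of_hasDerivAt
          (fun t _ => hasDerivAt_column (hm.differentiable (by simp)) _ _ t)
          (hc'.intervalIntegrable _ _)
      rw [← h3]
      exact abs_integral_le_unit hc' ⟨hs.1.le, hs.2⟩ hx)
  rw [← h1] at h2
  simpa using h2

theorem hasFDerivAt_param {K : V3 × ℝ → ℝ} (hK : ContDiff ℝ ∞ K) (x : V3) :
    HasFDerivAt (fun x => ∫ t in (0 : ℝ)..1, K (x, t))
      (∫ t in (0 : ℝ)..1, (fderiv ℝ K (x, t)).comp (ContinuousLinearMap.inl ℝ V3 ℝ)) x := by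
  have hcK := hK.continuous
  have hc : Continuous fun q : V3 × ℝ => (fderiv ℝ K q).comp (ContinuousLinearMap.inl ℝ V3 ℝ) :=
    (hK.continuous_fderiv (by simp)).clm_comp continuous_const
  obtain ⟨C, hC⟩ := ((isCompact_closedBall x 1).prod (isCompact_Icc (a := (0 : ℝ))
    (b := 1))).exists_bound_of_continuousOn hc.continuousOn
  refine intervalIntegral.hasFDerivAt_integral_of_dominated_of_fderiv_le
    (F := fun x t => K (x, t))
    (F' := fun x t => (fderiv ℝ K (x, t)).comp (ContinuousLinearMap.inl ℝ V3 ℝ))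
    (bound := fun _ => C) (Metric.closedBall_mem_nhds x one_pos) ?_ ?_ ?_ ?_ ?_ ?_
  · exact Eventually.of_forall fun y =>
      (hcK.comp (by fun_prop : Continuous fun t : ℝ => (y, t))).aestronglyMeasurable
  · exact (hcK.comp (by fun_prop : Continuous fun t : ℝ => (x, t))).intervalIntegrable _ _
  · exact (hc.comp (by fun_prop : Continuous fun t : ℝ => (x, t))).aestronglyMeasurable
  · refine ae_of_all _ fun t ht y hy => hC (y, t) ⟨hy, ?_⟩
    rw [uIoc_of_le (by norm_num)] at ht
    exact ⟨ht.1.le, ht.2⟩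
  · simp
  · refine ae_of_all _ fun t _ y _ => ?_
    exact ((hK.differentiable (by simp)) (y, t)).hasFDerivAt.comp y
      (hasFDerivAt_prodMk_left (𝕜 := ℝ) y t)

theorem contDiff_param {K : V3 × ℝ → ℝ} (hK : ContDiff ℝ ∞ K) :
    ContDiff ℝ 1 (fun x => ∫ t in (0 : ℝ)..1, K (x, t)) := by
  rw [contDiff_one_iff_hasFDerivAt]
  refine ⟨_, ?_, hasFDerivAt_param hK⟩
  refine intervalIntegral.continuous_parametric_intervalIntegral_of_continuous'
    (f := fun (x : V3) t => (fderiv ℝ K (x, t)).comp (ContinuousLinearMap.inl ℝ V3 ℝ)) ?_ 0 1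
  exact (hK.continuous_fderiv (by simp)).clm_comp continuous_const

/-- The vertical primitive `∫₀^{x₃} m`. -/
def vprim (m : V3 → ℝ) (x : V3) : ℝ := ∫ s in (0 : ℝ)..(x 2), m ![x 0, x 1, s]

theorem contDiff_mk3 {a b c : V3 × ℝ → ℝ} (ha : ContDiff ℝ ∞ a)
    (hb : ContDiff ℝ ∞ b) (hc : ContDiff ℝ ∞ c) :
    ContDiff ℝ ∞ fun x => (![a x, b x, c x] : V3) := by
  refine contDiff_pi.2 fun i => ?_
  fin_cases i <;> simpa

theorem contDiff_vprim_kernel {m : V3 → ℝ} (hm : ContDiff ℝ ∞ m) :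
    ContDiff ℝ ∞ fun q : V3 × ℝ => q.1 2 * m ![q.1 0, q.1 1, q.2 * q.1 2] := by
  have h : ∀ i : Fin 3, ContDiff ℝ ∞ fun q : V3 × ℝ => q.1 i := fun i =>
    (contDiff_apply ℝ ℝ i).comp contDiff_fst
  exact (h 2).mul (hm.comp (contDiff_mk3 (h 0) (h 1) (contDiff_snd.mul (h 2))))

theorem vprim_eq (m : V3 → ℝ) (x : V3) :
    vprim m x = ∫ t in (0 : ℝ)..1, x 2 * m ![x 0, x 1, t * x 2] := by
  have := intervalIntegral.mul_integral_comp_mul_right (a := 0) (b := 1)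
    (f := fun s => m ![x 0, x 1, s]) (x 2)
  rw [vprim, intervalIntegral.integral_const_mul]
  simpa using this.symm

theorem contDiff_vprim {m : V3 → ℝ} (hm : ContDiff ℝ ∞ m) : ContDiff ℝ 1 (vprim m) := by
  rw [funext (vprim_eq m)]
  exact contDiff_param (contDiff_vprim_kernel hm)

theorem pd_two_vprim {m : V3 → ℝ} (hm : ContDiff ℝ ∞ m) (x : V3) : pd 2 (vprim m) x = m x := by
  have h1 := hasDerivAt_column ((contDiff_vprim hm).differentiable (by simp)) (x 0) (x 1) (x 2)
  have hc := continuous_column hm.continuous (x 0) (x 1)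
  have h2 := intervalIntegral.integral_hasDerivAt_right (hc.intervalIntegrable 0 (x 2))
    (hc.stronglyMeasurableAtFilter _ _) hc.continuousAt
  have := h1.unique h2
  simpa only [vec3_eta] using this

theorem pd_vprim {m : V3 → ℝ} (hm : ContDiff ℝ ∞ m) {i : Fin 3} (hi : i ≠ 2) (x : V3) :
    pd i (vprim m) x = vprim (pd i m) x := by
  have hK := contDiff_vprim_kernel hm
  have h1 := (hasFDerivAt_param hK x).fderiv
  rw [← funext (vprim_eq m)] at h1
  have hc : Continuous fun t => (fderiv ℝ (fun q : V3 × ℝ => q.1 2 * m ![q.1 0, q.1 1, q.2 * q.1 2])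
      (x, t)).comp (ContinuousLinearMap.inl ℝ V3 ℝ) :=
    ((hK.continuous_fderiv (by simp)).comp
      (by fun_prop : Continuous fun t : ℝ => (x, t))).clm_comp continuous_const
  rw [pd, h1, ContinuousLinearMap.intervalIntegral_apply (hc.intervalIntegrable _ _), vprim_eq]
  congr 1
  ext t
  have h2 : HasFDerivAt (fun y : V3 => y 2 * m ![y 0, y 1, t * y 2])
      ((fderiv ℝ (fun q : V3 × ℝ => q.1 2 * m ![q.1 0, q.1 1, q.2 * q.1 2])
      (x, t)).comp (ContinuousLinearMap.inl ℝ V3 ℝ)) x :=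
    HasFDerivAt.comp (f := fun y : V3 => (y, t)) x
      ((hK.differentiable (by simp)) (x, t)).hasFDerivAt (hasFDerivAt_prodMk_left x t)
  have h3 := h2.hasLineDerivAt (Pi.single i 1)
  have h4 := (hasDerivAt_line (hm.differentiable (by simp)) i ![x 0, x 1, t * x 2]).const_mul (x 2)
  refine HasDerivAt.unique h3 ?_
  refine h4.congr_of_eventuallyEq (Eventually.of_forall fun h => ?_)
  have h5 : ((Pi.single i 1 : V3)) 2 = 0 := by simp [Ne.symm hi]
  simp only [Pi.add_apply, Pi.smul_apply, h5, smul_zero, add_zero]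
  congr 2
  ext j
  fin_cases j <;> simp [h5]

theorem abs_vprim_le {m : V3 → ℝ} (hm : Continuous m) {x : V3} (hx : x ∈ slab) :
    |vprim m x| ≤ vavg (fun y => |m y|) x :=
  abs_integral_le_unit (continuous_column hm _ _) (by simp) hx

end VerticalAverage

section RadialMean

open Set Filter Topology
open scoped ContDiff

theorem hasDerivAt_curve {f : V3 → ℝ} (hf : Differentiable ℝ f) {a b c : ℝ → ℝ} {a' b' c' t : ℝ}
    (ha : HasDerivAt a a' t) (hb : HasDerivAt b b' t) (hc : HasDerivAt c c' t) :
    HasDerivAt (fun t => f ![a t, b t, c t]) (a' * pd 0 f ![a t, b t, c t] +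
      b' * pd 1 f ![a t, b t, c t] + c' * pd 2 f ![a t, b t, c t]) t := by
  have h1 : HasDerivAt (fun t => (![a t, b t, c t] : V3)) ![a', b', c'] t := by
    refine hasDerivAt_pi.2 fun i => ?_
    fin_cases i <;> simpa
  have h2 := (hf ![a t, b t, c t]).hasFDerivAt.comp_hasDerivAt t h1
  refine h2.congr_deriv ?_
  conv_lhs => rw [pi_eq_sum_univ' ![a', b', c']]
  rw [map_sum, Fin.sum_univ_three]
  simp only [map_smul, smul_eq_mul, pd]
  rfl

theorem integral_swap_of_continuous {F : ℝ → ℝ → ℝ} (hF : Continuous (Function.uncurry F))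
    (a b c d : ℝ) : ∫ x in a..b, ∫ y in c..d, F x y = ∫ y in c..d, ∫ x in a..b, F x y := by
  refine intervalIntegral_intervalIntegral_swap ?_
  refine IntegrableOn.mono_set (t := uIcc a b ×ˢ uIcc c d) ?_
    (prod_mono uIoc_subset_uIcc uIoc_subset_uIcc)
  exact hF.continuousOn.integrableOn_compact (isCompact_uIcc.prod isCompact_uIcc)

theorem vavg_radial_eq_zero {u : V3 → V3} (hu : ContDiff ℝ ∞ u) (hdiv : DivFree u)
    (hper : PeriodicZ u) (hax : AxiSym (compR u)) (x : V3) :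
    vavg (fun y => y 0 * u y 0 + y 1 * u y 1) x = 0 := by
  have hU : ∀ j, ContDiff ℝ ∞ fun y => u y j := contDiff_pi.1 hu
  have hD : ∀ j, Differentiable ℝ fun y => u y j := fun j => (hU j).differentiable (by simp)
  have hcU : ∀ j, Continuous fun y => u y j := fun j => (hU j).continuous
  have hcP : ∀ i j, Continuous (pd i fun y => u y j) := fun i j =>
    (contDiff_pd (hU j) i).continuous
  let D : ℝ → ℝ → ℝ → ℝ := fun r θ z =>
    (Real.cos θ * u (cylPt r θ z) 0 + Real.sin θ * u (cylPt r θ z) 1) +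
    r * (Real.cos θ * (Real.cos θ * pd 0 (fun y => u y 0) (cylPt r θ z) +
        Real.sin θ * pd 1 (fun y => u y 0) (cylPt r θ z)) +
      Real.sin θ * (Real.cos θ * pd 0 (fun y => u y 1) (cylPt r θ z) +
        Real.sin θ * pd 1 (fun y => u y 1) (cylPt r θ z)))
  have hDr : ∀ r θ z, HasDerivAt (fun r => r * compR u r θ z) (D r θ z) r := by
    intro r θ z
    have h : ∀ j, HasDerivAt (fun r => u (cylPt r θ z) j)
        (Real.cos θ * pd 0 (fun y => u y j) (cylPt r θ z) +
        Real.sin θ * pd 1 (fun y => u y j) (cylPt r θ z)) r := fun j => by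
      have := hasDerivAt_curve (hD j) (hasDerivAt_mul_const (x := r) (Real.cos θ))
        (hasDerivAt_mul_const (x := r) (Real.sin θ)) (hasDerivAt_const r z)
      simpa [cylPt] using this
    refine ((hasDerivAt_id r).mul (((h 0).const_mul (Real.cos θ)).add
      ((h 1).const_mul (Real.sin θ)))).congr_deriv ?_
    simp [D]
  have hDindep : ∀ r θ z, D r θ z = D r 0 z := by
    intro r θ z
    refine (hDr r θ z).unique ?_
    simpa only [hax _ θ 0 z] using hDr r 0 z
  have hTh : ∀ r θ z, HasDerivAt (fun θ => compTheta u r θ z)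
      (-r * pd 2 (fun y => u y 2) (cylPt r θ z) - D r θ z) θ := by
    intro r θ z
    have h : ∀ j, HasDerivAt (fun θ => u (cylPt r θ z) j)
        (r * -Real.sin θ * pd 0 (fun y => u y j) (cylPt r θ z) +
        r * Real.cos θ * pd 1 (fun y => u y j) (cylPt r θ z)) θ := fun j => by
      have := hasDerivAt_curve (hD j) ((Real.hasDerivAt_cos θ).const_mul r)
        ((Real.hasDerivAt_sin θ).const_mul r) (hasDerivAt_const θ z)
      simpa [cylPt] using this
    refine (((Real.hasDerivAt_sin θ).neg.mul (h 0)).add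
      ((Real.hasDerivAt_cos θ).mul (h 1))).congr_deriv ?_
    have hdv := hdiv (cylPt r θ z)
    rw [Fin.sum_univ_three] at hdv
    simp only [D, Pi.neg_apply]
    linear_combination (r * pd 0 (fun y => u y 0) (cylPt r θ z) +
      r * pd 1 (fun y => u y 1) (cylPt r θ z)) * (Real.sin_sq_add_cos_sq θ) + r * hdv
  have hcpt : ∀ {X : Type} [TopologicalSpace X] {a b c : X → ℝ}, Continuous a → Continuous b →
      Continuous c → Continuous fun q => cylPt (a q) (b q) (c q) := by
    intro X _ a b c ha hb hc
    exact continuous_mk3 (by fun_prop) (by fun_prop) hc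
  have hcD : ∀ {X : Type} [TopologicalSpace X] {a b c : X → ℝ}, Continuous a → Continuous b →
      Continuous c → Continuous fun q => D (a q) (b q) (c q) := by
    intro X _ a b c ha hb hc
    have h := hcpt ha hb hc
    have h1 := fun j => (hcU j).comp h
    have h2 := fun i j => (hcP i j).comp h
    have h10 := h1 0
    have h11 := h1 1
    have h200 := h2 0 0
    have h201 := h2 0 1
    have h210 := h2 1 0
    have h211 := h2 1 1
    simp only [Function.comp_def] at h10 h11 h200 h201 h210 h211
    simp only [D]
    fun_prop
  have hcQ : ∀ {X : Type} [TopologicalSpace X] {a b c : X → ℝ}, Continuous a → Continuous b →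
      Continuous c → Continuous fun q => -(a q) * pd 2 (fun y => u y 2) (cylPt (a q) (b q) (c q)) :=
    fun ha hb hc => ha.neg.mul ((hcP 2 2).comp (hcpt ha hb hc))
  have hmeanθ : ∀ r z, 2 * Real.pi * D r 0 z =
      ∫ θ in (0 : ℝ)..(2 * Real.pi), -r * pd 2 (fun y => u y 2) (cylPt r θ z) := by
    intro r z
    have hc1 : Continuous fun θ => -r * pd 2 (fun y => u y 2) (cylPt r θ z) :=
      hcQ continuous_const continuous_id continuous_const
    have hc2 : Continuous fun θ => D r θ z :=
      hcD continuous_const continuous_id continuous_const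
    have h := intervalIntegral.integral_eq_sub_of_hasDerivAt (a := 0) (b := 2 * Real.pi)
      (fun θ _ => hTh r θ z) ((hc1.sub hc2).intervalIntegrable _ _)
    rw [intervalIntegral.integral_sub (hc1.intervalIntegrable _ _)
      (hc2.intervalIntegrable _ _)] at h
    simp only [hDindep r _ z, intervalIntegral.integral_const, smul_eq_mul] at h
    have h0 : compTheta u r (2 * Real.pi) z = compTheta u r 0 z := by
      simp [compTheta, cylPt]
    rw [h0] at h
    linarith
  have hmeanz : ∀ r, ∫ z in (0 : ℝ)..1, D r 0 z = 0 := by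
    intro r
    have h1 : 2 * Real.pi * ∫ z in (0 : ℝ)..1, D r 0 z = 0 := by
      rw [← intervalIntegral.integral_const_mul]
      simp only [hmeanθ]
      rw [integral_swap_of_continuous
        (F := fun z θ => -r * pd 2 (fun y => u y 2) (cylPt r θ z))
        (hcQ continuous_const continuous_snd continuous_fst)]
      refine (intervalIntegral.integral_congr fun θ _ => ?_).trans intervalIntegral.integral_zero
      rw [intervalIntegral.integral_const_mul]
      have h2 := intervalIntegral.integral_eq_sub_of_hasDerivAt (a := 0) (b := 1)
        (fun s _ => hasDerivAt_column (hD 2) (r * Real.cos θ) (r * Real.sin θ) s)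
        ((continuous_column (hcP 2 2) _ _).intervalIntegrable _ _)
      have h3 := congrFun (hper ![r * Real.cos θ, r * Real.sin θ, 0]) 2
      simp only [Matrix.cons_val, zero_add] at h3
      rw [h3, sub_self] at h2
      simp only [cylPt, h2, mul_zero]
    simpa [Real.pi_ne_zero] using h1
  have hn : ∀ r z, r * compR u r 0 z = ∫ ρ in (0 : ℝ)..r, D ρ 0 z := by
    intro r z
    have h := intervalIntegral.integral_eq_sub_of_hasDerivAt (a := 0) (b := r)
      (fun ρ _ => hDr ρ 0 z) ((hcD continuous_id continuous_const
        continuous_const).intervalIntegrable _ _)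
    simpa using h.symm
  let w : ℂ := ⟨x 0, x 1⟩
  have hx0 : x 0 = ‖w‖ * Real.cos w.arg := (Complex.norm_mul_cos_arg w).symm
  have hx1 : x 1 = ‖w‖ * Real.sin w.arg := (Complex.norm_mul_sin_arg w).symm
  have hm : ∀ s, x 0 * u ![x 0, x 1, s] 0 + x 1 * u ![x 0, x 1, s] 1 =
      ∫ ρ in (0 : ℝ)..‖w‖, D ρ 0 s := by
    intro s
    rw [← hn, ← hax _ w.arg 0 s, compR, cylPt, ← hx0, ← hx1]
    linear_combination u ![x 0, x 1, s] 0 * hx0 + u ![x 0, x 1, s] 1 * hx1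
  simp only [vavg, Matrix.cons_val, hm]
  rw [integral_swap_of_continuous (F := fun s ρ => D ρ 0 s)
    (hcD continuous_snd continuous_const continuous_fst)]
  simp only [hmeanz, intervalIntegral.integral_zero]

end RadialMean

section Cutoff

open Set Filter Topology
open scoped ContDiff

theorem exists_smooth_step : ∃ χ : ℝ → ℝ, ContDiff ℝ ∞ χ ∧ (∀ s, 0 ≤ χ s ∧ χ s ≤ 1) ∧
    (∀ s ≤ 1, χ s = 1) ∧ (∀ s, 4 ≤ s → χ s = 0) ∧
    ∃ K > 0, ∀ s, |deriv χ s| ≤ K ∧ |deriv (deriv χ) s| ≤ K ∧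
      (s ∉ Icc (1 : ℝ) 4 → deriv χ s = 0 ∧ deriv (deriv χ) s = 0) := by
  let χ : ℝ → ℝ := fun s => Real.smoothTransition ((4 - s) / 3)
  have hχ : ContDiff ℝ ∞ χ := Real.smoothTransition.contDiff.comp (by fun_prop)
  have h1 : ∀ s ≤ 1, χ s = 1 := fun s hs => Real.smoothTransition.one_of_one_le (by linarith)
  have h4 : ∀ s, 4 ≤ s → χ s = 0 := fun s hs =>
    Real.smoothTransition.zero_of_nonpos (by linarith)
  have hd : ∀ s, s ∉ Icc (1 : ℝ) 4 → deriv χ s = 0 := by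
    intro s hs
    rw [mem_Icc, not_and_or, not_le, not_le] at hs
    rcases hs with hs | hs
    · have : χ =ᶠ[𝓝 s] fun _ => 1 := by
        filter_upwards [gt_mem_nhds hs] with t ht using h1 t ht.le
      simp [this.deriv_eq]
    · have : χ =ᶠ[𝓝 s] fun _ => 0 := by
        filter_upwards [lt_mem_nhds hs] with t ht using h4 t ht.le
      simp [this.deriv_eq]
  have hd2 : ∀ s, s ∉ Icc (1 : ℝ) 4 → deriv (deriv χ) s = 0 := by
    intro s hs
    have : deriv χ =ᶠ[𝓝 s] fun _ => 0 := by
      filter_upwards [isClosed_Icc.isOpen_compl.mem_nhds hs] with t ht using hd t ht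
    simp [this.deriv_eq]
  have hcd : ContDiff ℝ ∞ (deriv χ) := (contDiff_infty_iff_deriv.1 hχ).2
  have hcd2 : ContDiff ℝ ∞ (deriv (deriv χ)) := (contDiff_infty_iff_deriv.1 hcd).2
  obtain ⟨K1, hK1⟩ := (isCompact_Icc (a := (1 : ℝ)) (b := 4)).exists_bound_of_continuousOn
    hcd.continuous.continuousOn
  obtain ⟨K2, hK2⟩ := (isCompact_Icc (a := (1 : ℝ)) (b := 4)).exists_bound_of_continuousOn
    hcd2.continuous.continuousOn
  have hK1' := (norm_nonneg _).trans (hK1 1 (by norm_num))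
  have hK2' := (norm_nonneg _).trans (hK2 1 (by norm_num))
  refine ⟨χ, hχ, fun s => ⟨Real.smoothTransition.nonneg _, Real.smoothTransition.le_one _⟩, h1, h4,
    K1 + K2 + 1, by linarith, fun s => ?_⟩
  refine ⟨?_, ?_, fun hs => ⟨hd s hs, hd2 s hs⟩⟩
  · by_cases hs : s ∈ Icc (1 : ℝ) 4
    · linarith [hK1 s hs, Real.norm_eq_abs (deriv χ s)]
    · rw [hd s hs, abs_zero]; linarith
  · by_cases hs : s ∈ Icc (1 : ℝ) 4
    · linarith [hK2 s hs, Real.norm_eq_abs (deriv (deriv χ) s)]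
    · rw [hd2 s hs, abs_zero]; linarith

/-- `φ` is a smooth radial cutoff equal to `1` for `|x'| ≤ R` and to `0` for `|x'| ≥ 2R`,
with horizontal gradient `g x'`. -/
structure IsCutoff (K R : ℝ) (φ g : V3 → ℝ) : Prop where
  smooth : ContDiff ℝ ∞ φ
  smooth_g : ContDiff ℝ ∞ g
  nonneg : ∀ x, 0 ≤ φ x
  le_one : ∀ x, φ x ≤ 1
  eq_one : ∀ x : V3, x 0 ^ 2 + x 1 ^ 2 ≤ R ^ 2 → φ x = 1
  eq_zero : ∀ x : V3, 4 * R ^ 2 ≤ x 0 ^ 2 + x 1 ^ 2 → φ x = 0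
  column : ∀ (x : V3) s, φ ![x 0, x 1, s] = φ x
  pd_eq : ∀ i x, pd i φ x = if i = 2 then 0 else g x * x i
  pd_two_g : ∀ x, pd 2 g x = 0
  abs_g : ∀ x, |g x| ≤ K / R ^ 2
  abs_pd_g : ∀ i x, |pd i g x| ≤ K / R ^ 3
  support_g : ∀ x : V3, ¬ (R ^ 2 ≤ x 0 ^ 2 + x 1 ^ 2 ∧ x 0 ^ 2 + x 1 ^ 2 ≤ 4 * R ^ 2) →
    g x = 0 ∧ ∀ i, pd i g x = 0

theorem pd_comp {χ : ℝ → ℝ} (hχ : Differentiable ℝ χ) {f : V3 → ℝ} (hf : Differentiable ℝ f)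
    (i : Fin 3) (x : V3) : pd i (fun y => χ (f y)) x = deriv χ (f x) * pd i f x := by
  have h := (hχ (f x)).hasDerivAt.comp_hasFDerivAt x (hf x).hasFDerivAt
  rw [pd, show (fun y => χ (f y)) = χ ∘ f from rfl, h.fderiv]
  simp [pd]

theorem abs_le_two_mul_of_sq_add_sq_le {a b R : ℝ} (hR : 0 ≤ R) (h : a ^ 2 + b ^ 2 ≤ 4 * R ^ 2) :
    |a| ≤ 2 * R ∧ |b| ≤ 2 * R :=
  ⟨abs_le_of_sq_le_sq (by nlinarith [sq_nonneg b]) (by linarith),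
    abs_le_of_sq_le_sq (by nlinarith [sq_nonneg a]) (by linarith)⟩

theorem exists_isCutoff : ∃ K > 0, ∃ φ g : ℝ → V3 → ℝ, ∀ R > 0, IsCutoff K R (φ R) (g R) := by
  obtain ⟨χ, hχ, h01, h1, h4, K, hK, hKd⟩ := exists_smooth_step
  let q : ℝ → V3 → ℝ := fun R y => (R ^ 2)⁻¹ * (y 0 * y 0 + y 1 * y 1)
  have hcd : ContDiff ℝ ∞ (deriv χ) := (contDiff_infty_iff_deriv.1 hχ).2
  have hc : ∀ i : Fin 3, ContDiff ℝ ∞ fun y : V3 => y i := fun i => contDiff_apply ℝ ℝ i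
  have hcD : ∀ i : Fin 3, Differentiable ℝ fun y : V3 => y i := fun i =>
    (hc i).differentiable (by simp)
  have hq : ∀ R, ContDiff ℝ ∞ (q R) := fun R =>
    contDiff_const.mul (((hc 0).mul (hc 0)).add ((hc 1).mul (hc 1)))
  have hqD : ∀ R, Differentiable ℝ (q R) := fun R => (hq R).differentiable (by simp)
  have hpq : ∀ R i x, pd i (q R) x = if i = 2 then 0 else 2 * (R ^ 2)⁻¹ * x i := by
    intro R i x
    have hs : ∀ j : Fin 3, Differentiable ℝ fun y : V3 => y j * y j := fun j =>
      (hcD j).mul (hcD j)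
    have hs2 : Differentiable ℝ fun y : V3 => y 0 * y 0 + y 1 * y 1 := (hs 0).add (hs 1)
    simp only [q]
    rw [pd_const_mul hs2, pd_add (hs 0) (hs 1), pd_mul (hcD 0) (hcD 0), pd_mul (hcD 1) (hcD 1),
      pd_coord, pd_coord]
    fin_cases i <;> simp <;> ring
  have hpg : ∀ R i x, pd i (fun y => 2 * (R ^ 2)⁻¹ * deriv χ (q R y)) x =
      2 * (R ^ 2)⁻¹ * (deriv (deriv χ) (q R x) * pd i (q R) x) := by
    intro R i x
    have hD := hcd.differentiable (by simp)
    have hDq : Differentiable ℝ fun y => deriv χ (q R y) := hD.comp (hqD R)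
    rw [pd_const_mul hDq, pd_comp hD (hqD R)]
  have hmem : ∀ R > 0, ∀ x : V3, q R x ∈ Icc (1 : ℝ) 4 ↔
      (R ^ 2 ≤ x 0 ^ 2 + x 1 ^ 2 ∧ x 0 ^ 2 + x 1 ^ 2 ≤ 4 * R ^ 2) := by
    intro R hR x
    have hR2 : 0 < R ^ 2 := by positivity
    simp only [q, mem_Icc]
    rw [inv_mul_eq_div, le_div_iff₀ hR2, div_le_iff₀ hR2, one_mul]
    ring_nf
  refine ⟨8 * K, by linarith, fun R x => χ (q R x), fun R x => 2 * (R ^ 2)⁻¹ * deriv χ (q R x),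
    fun R hR => ?_⟩
  have hR2 : 0 < R ^ 2 := by positivity
  refine ⟨hχ.comp (hq R), contDiff_const.mul (hcd.comp (hq R)), fun x => (h01 _).1,
    fun x => (h01 _).2, fun x hx => h1 _ ?_, fun x hx => h4 _ ?_, fun x s => ?_, fun i x => ?_,
    fun x => ?_, fun x => ?_, fun i x => ?_, fun x hx => ?_⟩
  · simp only [q]
    rw [inv_mul_eq_div, div_le_iff₀ hR2]
    linarith
  · simp only [q]
    rw [inv_mul_eq_div, le_div_iff₀ hR2]
    linarith
  · simp [q]
  · rw [pd_comp (hχ.differentiable (by simp)) (hqD R), hpq]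
    split_ifs <;> ring
  · rw [hpg, hpq]
    simp
  · rw [abs_mul, abs_of_pos (by positivity), div_eq_mul_inv]
    have := (hKd (q R x)).1
    have h3 : 0 < (R ^ 2)⁻¹ := by positivity
    nlinarith
  · rw [hpg, hpq]
    by_cases hx : q R x ∈ Icc (1 : ℝ) 4
    · have hx2 := abs_le_two_mul_of_sq_add_sq_le hR.le ((hmem R hR x).1 hx).2
      split_ifs with hi
      · simp only [mul_zero, abs_zero]
        positivity
      · have hxi : |x i| ≤ 2 * R := by
          fin_cases i
          · exact hx2.1
          · exact hx2.2
          · exact absurd rfl hi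
        have h2 := (hKd (q R x)).2.1
        have e : 8 * K / R ^ 3 = 2 * (R ^ 2)⁻¹ * (K * (2 * (R ^ 2)⁻¹ * (2 * R))) := by
          field_simp
          ring
        rw [e, abs_mul (2 * (R ^ 2)⁻¹), abs_mul (deriv (deriv χ) _), abs_mul (2 * (R ^ 2)⁻¹),
          abs_of_pos (by positivity : 0 < 2 * (R ^ 2)⁻¹)]
        gcongr
    · rw [((hKd _).2.2 hx).2]
      simp only [zero_mul, mul_zero, abs_zero]
      positivity
  · have hx' := (hKd (q R x)).2.2 (fun h => hx ((hmem R hR x).1 h))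
    refine ⟨by simp only [hx'.1, mul_zero], fun i => ?_⟩
    rw [hpg, hx'.2, zero_mul, mul_zero]

theorem IsCutoff.horizCompact {K R : ℝ} {φ g : V3 → ℝ} (h : IsCutoff K R φ g) :
    HorizCompact φ ∧ HorizCompact g := by
  have key : ∀ x : V3, 2 * |R| + 1 ≤ |x 0| ∨ 2 * |R| + 1 ≤ |x 1| →
      4 * R ^ 2 < x 0 ^ 2 + x 1 ^ 2 := by
    rintro x (hx | hx) <;>
    nlinarith [sq_abs R, sq_abs (x 0), sq_abs (x 1), abs_nonneg R, abs_nonneg (x 0),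
      abs_nonneg (x 1), sq_nonneg (x 0), sq_nonneg (x 1)]
  exact ⟨⟨_, fun x hx => h.eq_zero x (key x hx).le⟩,
    ⟨_, fun x hx => (h.support_g x fun h' => (key x hx).not_ge h'.2).1⟩⟩

theorem measureReal_box {L : ℝ} (hL : 0 ≤ L) : volume.real (box L) = 4 * L ^ 2 := by
  rw [Measure.real, box, Real.volume_Icc_pi_toReal]
  · simp [Fin.prod_univ_three]
    ring
  · intro i
    fin_cases i <;> simp <;> linarith

theorem abs_integral_slab_le {f : V3 → ℝ} {C R : ℝ} (hR : 0 < R)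
    (h0 : ∀ x : V3, 4 * R ^ 2 < x 0 ^ 2 + x 1 ^ 2 → f x = 0) (hC : ∀ x ∈ slab, |f x| ≤ C) :
    |∫ x in slab, f x| ≤ C * (64 * R ^ 2) := by
  rw [setIntegral_slab_eq_box (L := 4 * R)]
  · refine (norm_setIntegral_le_of_norm_le_const (f := f) (C := C) isCompact_Icc.measure_lt_top
      fun x hx => hC x (mem_box.1 hx).2.2).trans (le_of_eq ?_)
    rw [← box, measureReal_box (by linarith)]
    ring
  · rintro x (hx | hx) <;> refine h0 x ?_ <;>
    nlinarith [sq_abs (x 0), sq_abs (x 1), abs_nonneg (x 0),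
      abs_nonneg (x 1), sq_nonneg (x 0), sq_nonneg (x 1)]

theorem IsCutoff.integral_le {K R : ℝ} (hR : 0 < R) {φ g : V3 → ℝ} (h : IsCutoff K R φ g) :
    ∫ x in slab, φ x ≤ 64 * R ^ 2 := by
  have := abs_integral_slab_le (C := 1) hR (fun x hx => h.eq_zero x hx.le)
    fun x _ => by rw [abs_of_nonneg (h.nonneg x)]; exact h.le_one x
  linarith [le_abs_self (∫ x in slab, φ x)]

theorem IsCutoff.le_integral {K R : ℝ} (hR : 0 < R) {φ g : V3 → ℝ} (h : IsCutoff K R φ g) :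
    R ^ 2 ≤ ∫ x in slab, φ x := by
  have hsub : box (R / 2) ⊆ slab := fun x hx => (mem_box.1 hx).2.2
  have h1 : ∫ x in box (R / 2), φ x ≤ ∫ x in slab, φ x :=
    setIntegral_mono_set (h.horizCompact.1.integrableOn h.smooth.continuous)
      (ae_of_all _ h.nonneg) hsub.eventuallyLE
  have h2 : ∫ x in box (R / 2), φ x = ∫ x in box (R / 2), (1 : ℝ) := by
    refine setIntegral_congr_fun measurableSet_Icc fun x hx => h.eq_one x ?_
    obtain ⟨hx0, hx1, _⟩ := mem_box.1 hx
    nlinarith [sq_abs (x 0), sq_abs (x 1), abs_nonneg (x 0), abs_nonneg (x 1)]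
  rw [h2, setIntegral_const, measureReal_box (by linarith)] at h1
  refine le_trans (le_of_eq ?_) h1
  simp
  ring

end Cutoff

section Pressure

open Set Filter Topology
open scoped ContDiff

@[fun_prop]
theorem ContDiff.differentiable_pd {f : V3 → ℝ} (hf : ContDiff ℝ ∞ f) (i : Fin 3) :
    Differentiable ℝ (pd i f) :=
  (contDiff_pd hf i).differentiable (by simp)

theorem pd_const (c : ℝ) (i : Fin 3) (x : V3) : pd i (fun _ => c) x = 0 := by
  simp [pd]

theorem pd_neg (f : V3 → ℝ) (i : Fin 3) (x : V3) : pd i (fun y => -f y) x = -pd i f x := by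
  simp [pd, fderiv_fun_neg]

theorem eq_const_of_pd_eq_zero {f : V3 → ℝ} (hf : Differentiable ℝ f) (h : ∀ i x, pd i f x = 0)
    (x y : V3) : f x = f y := by
  refine is_const_of_fderiv_eq_zero hf (fun z => ?_) x y
  ext v
  rw [pi_eq_sum_univ' v]
  simp only [map_sum, map_smul]
  refine (Finset.sum_eq_zero fun i _ => ?_).trans (by simp)
  have h' := h i z
  rw [pd] at h'
  simp [h']

/-- `1`-periodicity of a scalar function in the vertical variable. -/
def VertPeriodic (f : V3 → ℝ) : Prop := ∀ x, f (x + Pi.single 2 1) = f x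

theorem VertPeriodic.pd {f : V3 → ℝ} (hf : VertPeriodic f) (i : Fin 3) :
    VertPeriodic (pd i f) := by
  intro x
  have := fderiv_comp_add_right (𝕜 := ℝ) (f := f) (x := x) (Pi.single 2 1)
  rw [funext hf] at this
  simp [_root_.pd, this]

theorem VertPeriodic.one_eq_zero {f : V3 → ℝ} (hf : VertPeriodic f) (a b : ℝ) :
    f ![a, b, 1] = f ![a, b, 0] := by
  rw [← hf ![a, b, 0]]
  congr 1
  ext i
  fin_cases i <;> simp

theorem PeriodicZ.vertPeriodic {u : V3 → V3} (hu : PeriodicZ u) (j : Fin 3) :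
    VertPeriodic fun y => u y j := by
  intro x
  simp only [← hu x]
  congr 1
  ext i
  fin_cases i <;> simp

theorem IsMHD.exists_pressure_shift {δ : ℝ} {u b : V3 → V3} {p : V3 → ℝ}
    (h : IsMHD δ u b p) (hp : ContDiff ℝ ∞ p) (hup : PeriodicZ u) (hbp : PeriodicZ b) :
    ∃ κ : ℝ, ∀ x, p (x + Pi.single 2 1) = p x + κ := by
  have hpd : ∀ i, VertPeriodic (pd i p) := by
    intro i x
    have hl : ∀ (f : V3 → ℝ), VertPeriodic f → VertPeriodic (lap f) := by
      intro f hf x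
      simp only [lap, ((hf.pd _).pd _) x]
    have h1 := h.1 x i
    have h2 := h.1 (x + Pi.single 2 1) i
    simp only [((hup.vertPeriodic _).pd _) x, ((hbp.vertPeriodic _).pd _) x,
      hup.vertPeriodic _ x, hbp.vertPeriodic _ x, hl _ (hup.vertPeriodic _) x] at h2
    linarith
  have hD : Differentiable ℝ p := hp.differentiable (by simp)
  have hD' : Differentiable ℝ fun x : V3 => p (x + Pi.single 2 1) :=
    hD.comp (differentiable_id.add_const _)
  refine ⟨p (0 + Pi.single 2 1) - p 0, fun x => ?_⟩
  have := eq_const_of_pd_eq_zero (f := fun x => p (x + Pi.single 2 1) - p x) (hD'.sub hD)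
    (fun i x => ?_) x 0
  · linarith
  · rw [pd_sub hD' hD, sub_eq_zero, ← hpd i x, pd, fderiv_comp_add_right, pd]

theorem integral_slab_div3_eq_zero {F G H : V3 → ℝ} (hF : ContDiff ℝ 1 F) (hG : ContDiff ℝ 1 G)
    (hH : ContDiff ℝ 1 H) (cF : HorizCompact F) (cG : HorizCompact G) (cH : HorizCompact H)
    (hper : ∀ x y, H ![x, y, 1] = H ![x, y, 0]) :
    ∫ x in slab, (pd 0 F x + pd 1 G x + pd 2 H x) = 0 := by
  have := integral_slab_div_eq_zero (F := ![F, G, H]) (fun i => by fin_cases i <;> assumption)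
    (fun i => by fin_cases i <;> assumption) hper
  simpa [Fin.sum_univ_three] using this

theorem horizCompact_of_eq_zero {f : V3 → ℝ} {R : ℝ}
    (h0 : ∀ x : V3, 4 * R ^ 2 < x 0 ^ 2 + x 1 ^ 2 → f x = 0) : HorizCompact f := by
  refine ⟨2 * |R| + 1, ?_⟩
  rintro x (hx | hx) <;> refine h0 x ?_ <;>
  nlinarith [sq_abs R, sq_abs (x 0), sq_abs (x 1), abs_nonneg R, abs_nonneg (x 0),
    abs_nonneg (x 1), sq_nonneg (x 0), sq_nonneg (x 1)]

theorem IsMHD.pressure_shift_identity {δ κ K R : ℝ} {u b : V3 → V3} {p φ g : V3 → ℝ}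
    (h : IsMHD δ u b p) (hu : ContDiff ℝ ∞ u) (hb : ContDiff ℝ ∞ b) (hp : ContDiff ℝ ∞ p)
    (hup : PeriodicZ u) (hbp : PeriodicZ b) (hκ : ∀ x, p (x + Pi.single 2 1) = p x + κ)
    (hφ : IsCutoff K R φ g) :
    ∫ x in slab, (κ * φ x - u x 2 * (2 * g x + x 0 * pd 0 g x + x 1 * pd 1 g x)
      - g x * (x 0 * u x 0 + x 1 * u x 1) * u x 2
      + g x * (x 0 * b x 0 + x 1 * b x 1) * b x 2) = 0 := by
  have cφ := hφ.smooth
  have cg := hφ.smooth_g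
  have dφ : Differentiable ℝ φ := cφ.differentiable (by simp)
  have dg : Differentiable ℝ g := cg.differentiable (by simp)
  have dp : Differentiable ℝ p := hp.differentiable (by simp)
  have du : Differentiable ℝ u := hu.differentiable (by simp)
  have db : Differentiable ℝ b := hb.differentiable (by simp)
  have hc := hφ.horizCompact
  have cpd : ∀ j, ContDiff ℝ ∞ (pd j fun y => u y 2) := fun j => contDiff_pd (by fun_prop) j
  have cF : ∀ j : Fin 3, ContDiff ℝ ∞ (fun x => φ x * (pd j (fun y => u y 2) x - u x j * u x 2
      + b x j * b x 2) + g x * (-(x j * u x 2))) := by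
    intro j
    have := cpd j
    fun_prop
  have cG : ContDiff ℝ ∞ (fun x => φ x * (pd 2 (fun y => u y 2) x - u x 2 * u x 2
      + b x 2 * b x 2 - (p x - κ * x 2))) := by
    have := cpd 2
    fun_prop
  have key := integral_slab_div3_eq_zero ((cF 0).of_le (by simp)) ((cF 1).of_le (by simp))
    (cG.of_le (by simp)) ((hc.1.mul_right _).add (hc.2.mul_right _))
    ((hc.1.mul_right _).add (hc.2.mul_right _)) (hc.1.mul_right _) ?_
  · rw [← key]
    refine setIntegral_congr_fun measurableSet_slab fun x _ => ?_
    have e := h.1 x 2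
    have du' := h.2.2.1 x
    have db' := h.2.2.2 x
    simp only [lap, Fin.sum_univ_three] at e du' db'
    simp (disch := fun_prop) only [pd_add, pd_mul, pd_sub, pd_neg, pd_coord, pd_const,
      hφ.pd_eq]
    simp
    linear_combination φ x * e + φ x * u x 2 * du' - φ x * b x 2 * db'
  · intro a c
    have e1 := ((hup.vertPeriodic 2).pd 2).one_eq_zero a c
    have e2 := (hup.vertPeriodic 2).one_eq_zero a c
    have e3 := (hbp.vertPeriodic 2).one_eq_zero a c
    have e4 : p ![a, c, 1] = p ![a, c, 0] + κ := by
      rw [← hκ]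
      congr 1
      ext i
      fin_cases i <;> simp
    have e5 := hφ.column ![a, c, 0] 1
    simp only [e1, e2, e3, e4, Matrix.cons_val] at e5 ⊢
    rw [e5]
    ring

theorem IsMHD.vertPeriodic_pressure {δ : ℝ} {u b : V3 → V3} {p : V3 → ℝ}
    (h : IsMHD δ u b p) (hu : ContDiff ℝ ∞ u) (hb : ContDiff ℝ ∞ b) (hp : ContDiff ℝ ∞ p)
    (hup : PeriodicZ u) (hbp : PeriodicZ b) (hubd : Bounded3 u) (hbbd : Bounded3 b) :
    VertPeriodic p := by
  obtain ⟨κ, hκ⟩ := h.exists_pressure_shift hp hup hbp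
  suffices hκ0 : κ = 0 by
    intro x
    rw [hκ, hκ0, add_zero]
  obtain ⟨M, hM⟩ := hubd
  obtain ⟨M', hM'⟩ := hbbd
  have hMu : ∀ x i, |u x i| ≤ |M| + |M'| + 1 := fun x i => by
    linarith [norm_le_pi_norm (u x) i, Real.norm_eq_abs (u x i), hM x, le_abs_self M,
      abs_nonneg M']
  have hMb : ∀ x i, |b x i| ≤ |M| + |M'| + 1 := fun x i => by
    linarith [norm_le_pi_norm (b x) i, Real.norm_eq_abs (b x i), hM' x, le_abs_self M',
      abs_nonneg M]
  obtain ⟨N, hN, hMu, hMb⟩ : ∃ N > 0, (∀ x i, |u x i| ≤ N) ∧ ∀ x i, |b x i| ≤ N :=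
    ⟨_, by positivity, hMu, hMb⟩
  obtain ⟨K, hK, φ, g, hφ⟩ := exists_isCutoff
  have main : ∀ R ≥ 1, |κ| * R ≤ (6 * N * K + 8 * K * N ^ 2) * 64 := by
    intro R hR
    have hR0 : 0 < R := by linarith
    have hφR := hφ R hR0
    have hid := h.pressure_shift_identity hu hb hp hup hbp hκ hφR
    let A : V3 → ℝ := fun x => u x 2 * (2 * g R x + x 0 * pd 0 (g R) x + x 1 * pd 1 (g R) x)
      + g R x * (x 0 * u x 0 + x 1 * u x 1) * u x 2 - g R x * (x 0 * b x 0 + x 1 * b x 1) * b x 2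
    have cA : Continuous A := by
      have c0 := (contDiff_pd hφR.smooth_g 0).continuous
      have c1 := (contDiff_pd hφR.smooth_g 1).continuous
      have cg := hφR.smooth_g.continuous
      have cu := hu.continuous
      have cb := hb.continuous
      fun_prop
    have hA0 : ∀ x : V3, 4 * R ^ 2 < x 0 ^ 2 + x 1 ^ 2 → A x = 0 := by
      intro x hx
      obtain ⟨h1, h2⟩ := hφR.support_g x fun h' => hx.not_ge h'.2
      simp [A, h1, h2]
    have hAle : ∀ x ∈ slab, |A x| ≤ (6 * N * K + 8 * K * N ^ 2) / R := by
      intro x _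
      by_cases hx : x 0 ^ 2 + x 1 ^ 2 ≤ 4 * R ^ 2
      · obtain ⟨hx0, hx1⟩ := abs_le_two_mul_of_sq_add_sq_le hR0.le hx
        have hg := hφR.abs_g x
        calc |A x| ≤ |u x 2| * (2 * |g R x| + |x 0| * |pd 0 (g R) x| + |x 1| * |pd 1 (g R) x|)
            + |g R x| * (|x 0| * |u x 0| + |x 1| * |u x 1|) * |u x 2|
            + |g R x| * (|x 0| * |b x 0| + |x 1| * |b x 1|) * |b x 2| := by
              simp only [A]
              refine (abs_sub _ _).trans (add_le_add ((abs_add_le _ _).trans (add_le_add ?_ ?_)) ?_)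
              all_goals
                simp only [abs_mul]
                gcongr
                simp only [← abs_mul]
                first
                | exact abs_add_le _ _
                | exact (abs_add_three _ _ _).trans (by simp [abs_mul])
          _ ≤ N * (2 * (K / R ^ 2) + 2 * R * (K / R ^ 3) + 2 * R * (K / R ^ 3))
            + K / R ^ 2 * (2 * R * N + 2 * R * N) * N
            + K / R ^ 2 * (2 * R * N + 2 * R * N) * N := by
              gcongr <;> first | exact hMu _ _ | exact hMb _ _ | exact hφR.abs_pd_g _ _
          _ = 6 * N * K / R ^ 2 + 8 * K * N ^ 2 / R := by field_simp; ring
          _ ≤ 6 * N * K / R + 8 * K * N ^ 2 / R := by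
              gcongr
              nlinarith
          _ = _ := by ring
      · rw [hA0 x (not_le.1 hx), abs_zero]
        positivity
    have hJ := abs_integral_slab_le hR0 hA0 hAle
    have hφJ := hφR.le_integral hR0
    have hsplit : κ * ∫ x in slab, φ R x = ∫ x in slab, A x := by
      rw [← integral_const_mul, ← sub_eq_zero, ← integral_sub, ← hid]
      · congr 1
        ext x
        simp only [A]
        ring
      · exact (hφR.horizCompact.1.integrableOn hφR.smooth.continuous).const_mul κ
      · exact (horizCompact_of_eq_zero hA0).integrableOn cA
    rw [← hsplit, abs_mul, abs_of_nonneg ((sq_nonneg R).trans hφJ)] at hJ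
    have h3 : |κ| * R ^ 2 ≤ (6 * N * K + 8 * K * N ^ 2) / R * (64 * R ^ 2) :=
      (mul_le_mul_of_nonneg_left hφJ (abs_nonneg κ)).trans hJ
    have h4 : (6 * N * K + 8 * K * N ^ 2) / R * (64 * R ^ 2) =
        (6 * N * K + 8 * K * N ^ 2) * 64 * R := by field_simp
    rw [h4] at h3
    nlinarith
  by_contra hne
  have hpos : 0 < |κ| := abs_pos.2 hne
  set B := (6 * N * K + 8 * K * N ^ 2) * 64 with hB
  have hB0 : 0 < B := by positivity
  have h5 := main (B / |κ| + 1) (by linarith [div_pos hB0 hpos])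
  rw [mul_add, mul_div_cancel₀ _ hpos.ne'] at h5
  linarith

end Pressure

section Energy

open Set Filter Topology
open scoped ContDiff

/-- Total Dirichlet density. -/
def dens (u b : V3 → V3) (x : V3) : ℝ := gradSq u x + gradSq b x

/-- The remainder in the local energy identity, with `W` a vertical primitive of `x' · u'`
and `Y = (∇ × b) × b`. -/
def energyRest (δ : ℝ) (u b Y : V3 → V3) (W g : V3 → ℝ) (x : V3) : ℝ :=
  (∑ j, (u x j ^ 2 + b x j ^ 2)) / 2 * g x * (x 0 * u x 0 + x 1 * u x 1)
    - (∑ j, u x j * b x j) * g x * (x 0 * b x 0 + x 1 * b x 1)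
    - g x * (x 0 * ∑ j, (u x j * pd 0 (fun y => u y j) x + b x j * pd 0 (fun y => b y j) x))
    - g x * (x 1 * ∑ j, (u x j * pd 1 (fun y => u y j) x + b x j * pd 1 (fun y => b y j) x))
    - δ * g x * (x 0 * (Y x 1 * b x 2 - Y x 2 * b x 1) + x 1 * (Y x 2 * b x 0 - Y x 0 * b x 2))
    + W x * (pd 0 g x * pd 0 (fun y => u y 2) x + pd 1 g x * pd 1 (fun y => u y 2) x)
    + g x * (pd 0 W x * pd 0 (fun y => u y 2) x + pd 1 W x * pd 1 (fun y => u y 2) x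
      + (x 0 * u x 0 + x 1 * u x 1) * pd 2 (fun y => u y 2) x)
    + g x * W x * ∑ j, (u x j * pd j (fun y => u y 2) x - b x j * pd j (fun y => b y 2) x)

theorem contDiff_cross3 {a c : V3 → V3} (ha : ContDiff ℝ ∞ a) (hc : ContDiff ℝ ∞ c) :
    ContDiff ℝ ∞ fun x => cross3 (a x) (c x) := by
  refine contDiff_pi.2 fun i => ?_
  fin_cases i <;> simp [cross3] <;> fun_prop

theorem contDiff_curl {b : V3 → V3} (hb : ContDiff ℝ ∞ b) : ContDiff ℝ ∞ (curl b) := by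
  have h : ∀ i j, ContDiff ℝ ∞ (pd i fun y => b y j) := fun i j => contDiff_pd (by fun_prop) i
  refine contDiff_pi.2 fun i => ?_
  fin_cases i <;> simp [curl] <;> exact (h _ _).sub (h _ _)

theorem IsMHD.integral_energy {δ K R : ℝ} {u b Y : V3 → V3} {p φ g W : V3 → ℝ}
    (h : IsMHD δ u b p) (hu : ContDiff ℝ ∞ u) (hb : ContDiff ℝ ∞ b) (hp : ContDiff ℝ ∞ p)
    (hup : PeriodicZ u) (hbp : PeriodicZ b) (hpp : VertPeriodic p) (hφ : IsCutoff K R φ g)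
    (hY : Y = fun y => cross3 (curl b y) (b y)) (hW : ContDiff ℝ 1 W)
    (hW2 : ∀ x, pd 2 W x = x 0 * u x 0 + x 1 * u x 1) (hW0 : ∀ x y, W ![x, y, 0] = 0)
    (hW1 : ∀ x y, W ![x, y, 1] = 0) :
    ∫ x in slab, (energyRest δ u b Y W g x - φ x * dens u b x) = 0 := by
  have cφ := hφ.smooth
  have cg := hφ.smooth_g
  have cφ1 : ContDiff ℝ 1 φ := cφ.of_le (by simp)
  have cg1 : ContDiff ℝ 1 g := cg.of_le (by simp)
  have cu1 : ContDiff ℝ 1 u := hu.of_le (by simp)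
  have cb1 : ContDiff ℝ 1 b := hb.of_le (by simp)
  have cp1 : ContDiff ℝ 1 p := hp.of_le (by simp)
  have hYc : ContDiff ℝ ∞ Y := hY ▸ contDiff_cross3 (contDiff_curl hb) hb
  have cY1 : ContDiff ℝ 1 Y := hYc.of_le (by simp)
  have dφ : Differentiable ℝ φ := cφ.differentiable (by simp)
  have dg : Differentiable ℝ g := cg.differentiable (by simp)
  have dp : Differentiable ℝ p := hp.differentiable (by simp)
  have du : Differentiable ℝ u := hu.differentiable (by simp)
  have db : Differentiable ℝ b := hb.differentiable (by simp)
  have dY : Differentiable ℝ Y := hYc.differentiable (by simp)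
  have dW : Differentiable ℝ W := hW.differentiable (by simp)
  have hc := hφ.horizCompact
  have cpu : ∀ i j, ContDiff ℝ 1 (pd i fun y => u y j) := fun i j =>
    (contDiff_pd (by fun_prop) i).of_le (by simp)
  have cpb : ∀ i j, ContDiff ℝ 1 (pd i fun y => b y j) := fun i j =>
    (contDiff_pd (by fun_prop) i).of_le (by simp)
  let A : Fin 3 → Fin 3 → Fin 3 → V3 → ℝ := fun i k l x =>
    (1 / 2 * (u x 0 * u x 0 + u x 1 * u x 1 + u x 2 * u x 2 + b x 0 * b x 0 + b x 1 * b x 1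
      + b x 2 * b x 2) + p x) * u x i
    - (u x 0 * b x 0 + u x 1 * b x 1 + u x 2 * b x 2) * b x i
    - (u x 0 * pd i (fun y => u y 0) x + u x 1 * pd i (fun y => u y 1) x
      + u x 2 * pd i (fun y => u y 2) x)
    - (b x 0 * pd i (fun y => b y 0) x + b x 1 * pd i (fun y => b y 1) x
      + b x 2 * pd i (fun y => b y 2) x)
    - δ * (Y x k * b x l - Y x l * b x k)
  have cA : ∀ i k l, ContDiff ℝ 1 (A i k l) := by
    intro i k l
    have c := fun j => cpu i j
    have c' := fun j => cpb i j
    simp only [A]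
    fun_prop
  have cF : ∀ i k l, ContDiff ℝ 1 fun x =>
      φ x * A i k l x + g x * (W x * pd i (fun y => u y 2) x) := by
    intro i k l
    have c := cpu i 2
    have c' := cA i k l
    fun_prop
  have cG : ContDiff ℝ 1 fun x => φ x * A 2 0 1 x + g x * (W x * pd 2 (fun y => u y 2) x
      - p x * W x) := by
    have c := cpu 2 2
    have c' := cA 2 0 1
    fun_prop
  have hYb : ∀ x, Y x 0 * (pd 1 (fun y => b y 2) x - pd 2 (fun y => b y 1) x)
      + Y x 1 * (pd 2 (fun y => b y 0) x - pd 0 (fun y => b y 2) x)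
      + Y x 2 * (pd 0 (fun y => b y 1) x - pd 1 (fun y => b y 0) x) = 0 := by
    intro x
    simp only [hY, cross3, curl, Matrix.cons_val]
    ring
  have key := integral_slab_div3_eq_zero (cF 0 1 2) (cF 1 2 0) cG
    ((hc.1.mul_right _).add (hc.2.mul_right _)) ((hc.1.mul_right _).add (hc.2.mul_right _))
    ((hc.1.mul_right _).add (hc.2.mul_right _)) ?_
  · rw [← key]
    refine setIntegral_congr_fun measurableSet_slab fun x _ => ?_
    have e := h.1 x
    have e' := h.2.1 x
    rw [← hY] at e'
    have e0 := e 0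
    have e1 := e 1
    have e2 := e 2
    have e0' := e' 0
    have e1' := e' 1
    have e2' := e' 2
    have du' := h.2.2.1 x
    have db' := h.2.2.2 x
    have hYb' := hYb x
    clear e e'
    simp only [lap, Fin.sum_univ_three, curl, Matrix.cons_val] at e0 e1 e2 e0' e1' e2' du' db'
    simp only [A]
    simp (disch := fun_prop) only [pd_add, pd_mul, pd_sub, pd_const,
      hφ.pd_eq, hW2, hφ.pd_two_g]
    simp only [energyRest, dens, gradSq, Fin.sum_univ_three]
    simp
    linear_combination -φ x * (u x 0 * e0 + u x 1 * e1 + u x 2 * e2 + b x 0 * e0' + b x 1 * e1'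
      + b x 2 * e2') + g x * W x * e2 - φ x * (1 / 2 * (u x 0 * u x 0 + u x 1 * u x 1
      + u x 2 * u x 2 + b x 0 * b x 0 + b x 1 * b x 1 + b x 2 * b x 2) + p x) * du'
      + φ x * (u x 0 * b x 0 + u x 1 * b x 1 + u x 2 * b x 2) * db' - δ * φ x * hYb'
  · intro x y
    have hbv := fun j => hbp.vertPeriodic j
    have huv := fun j => hup.vertPeriodic j
    have e1 := fun j => (huv j).one_eq_zero x y
    have e2 := fun j => (hbv j).one_eq_zero x y
    have e3 := fun j => ((huv j).pd 2).one_eq_zero x y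
    have e4 := fun j => ((hbv j).pd 2).one_eq_zero x y
    have e5 : ∀ i j, pd i (fun y => b y j) ![x, y, 1] = pd i (fun y => b y j) ![x, y, 0] :=
      fun i j => ((hbv j).pd i).one_eq_zero x y
    have e6 : Y ![x, y, 1] = Y ![x, y, 0] := by
      simp only [hY, curl, cross3, e5, e2]
    have e7 := hφ.column ![x, y, 0] 1
    simp only [Matrix.cons_val] at e7
    simp only [A, hW0, hW1, e1, e2, e3, e4, e6, e7, hpp.one_eq_zero x y, mul_zero, zero_mul,
      sub_zero]

end Energy

section RestBound

open Set Filter Topology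
open scoped ContDiff

theorem vavg_le_of_column {f g : V3 → ℝ} (hf : Continuous f) (hg : Continuous g) {x : V3}
    (h : ∀ s, f ![x 0, x 1, s] ≤ g ![x 0, x 1, s]) : vavg f x ≤ vavg g x :=
  intervalIntegral.integral_mono_on (by norm_num)
    ((continuous_column hf _ _).intervalIntegrable _ _)
    ((continuous_column hg _ _).intervalIntegrable _ _) fun s _ => h s

theorem vavg_const_mul (c : ℝ) (f : V3 → ℝ) (x : V3) :
    vavg (fun y => c * f y) x = c * vavg f x := by
  simp [vavg]

theorem vavg_const_add_mul (a c : ℝ) {f : V3 → ℝ} (hf : Continuous f) (x : V3) :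
    vavg (fun y => a + c * f y) x = a + c * vavg f x := by
  have h := (continuous_column hf (x 0) (x 1)).intervalIntegrable (μ := volume) 0 1
  simp [vavg, intervalIntegral.integral_add intervalIntegrable_const (h.const_mul c)]

theorem abs_add_le_of_le {a b A B : ℝ} (ha : |a| ≤ A) (hb : |b| ≤ B) : |a + b| ≤ A + B :=
  (abs_add_le a b).trans (add_le_add ha hb)

theorem abs_sub_le_of_le {a b A B : ℝ} (ha : |a| ≤ A) (hb : |b| ≤ B) : |a - b| ≤ A + B :=
  (abs_sub a b).trans (add_le_add ha hb)

theorem abs_mul_le_of_le {a b A B : ℝ} (ha : |a| ≤ A) (hb : |b| ≤ B) : |a * b| ≤ A * B := by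
  rw [abs_mul]
  exact mul_le_mul ha hb (abs_nonneg b) ((abs_nonneg a).trans ha)

theorem continuous_dens {u b : V3 → V3} (hu : ContDiff ℝ ∞ u) (hb : ContDiff ℝ ∞ b) :
    Continuous (dens u b) := by
  have h : ∀ (v : V3 → V3), ContDiff ℝ ∞ v → Continuous (gradSq v) := fun v hv =>
    continuous_finsetSum _ fun i _ => continuous_finsetSum _ fun j _ =>
      (contDiff_pd (f := fun y => v y j) (by fun_prop) i).continuous.pow 2
  exact (h u hu).add (h b hb)

theorem gradSq_nonneg (u : V3 → V3) (x : V3) : 0 ≤ gradSq u x :=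
  Finset.sum_nonneg fun _ _ => Finset.sum_nonneg fun _ _ => sq_nonneg _

theorem dens_nonneg (u b : V3 → V3) (x : V3) : 0 ≤ dens u b x :=
  add_nonneg (gradSq_nonneg u x) (gradSq_nonneg b x)

theorem sq_pd_le_gradSq (u : V3 → V3) (i j : Fin 3) (x : V3) :
    pd i (fun y => u y j) x ^ 2 ≤ gradSq u x :=
  (Finset.single_le_sum (f := fun j => pd i (fun y => u y j) x ^ 2)
    (fun _ _ => sq_nonneg _) (Finset.mem_univ j)).trans
    (Finset.single_le_sum (f := fun i => ∑ j, pd i (fun y => u y j) x ^ 2)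
      (fun _ _ => Finset.sum_nonneg fun _ _ => sq_nonneg _) (Finset.mem_univ i))

theorem abs_pd_le_sqrt_dens (u b : V3 → V3) (i j : Fin 3) (x : V3) :
    |pd i (fun y => u y j) x| ≤ √(dens u b x) ∧ |pd i (fun y => b y j) x| ≤ √(dens u b x) :=
  ⟨Real.abs_le_sqrt ((sq_pd_le_gradSq u i j x).trans
      (le_add_of_nonneg_right (gradSq_nonneg b x))),
    Real.abs_le_sqrt ((sq_pd_le_gradSq b i j x).trans
      (le_add_of_nonneg_left (gradSq_nonneg u x)))⟩

theorem pd_radial {u : V3 → V3} (hu : Differentiable ℝ u) (i : Fin 3) (x : V3) :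
    pd i (fun y => y 0 * u y 0 + y 1 * u y 1) x =
      (x 0 * pd i (fun y => u y 0) x + u x 0 * if i = 0 then 1 else 0) +
      (x 1 * pd i (fun y => u y 1) x + u x 1 * if i = 1 then 1 else 0) := by
  simp (disch := fun_prop) only [pd_add, pd_mul, pd_coord]

variable {u : V3 → V3} {s : V3 → ℝ} {R N : ℝ} {x : V3}

theorem abs_radial_le (hu : ContDiff ℝ ∞ u) (hs : Continuous s)
    (hus : ∀ i j y, |pd i (fun y => u y j) y| ≤ s y) (hx0 : |x 0| ≤ 2 * R) (hx1 : |x 1| ≤ 2 * R)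
    (hx : x ∈ slab) (hav : vavg (fun y => y 0 * u y 0 + y 1 * u y 1) x = 0) :
    |x 0 * u x 0 + x 1 * u x 1| ≤ 4 * R * vavg s x := by
  have hm : ContDiff ℝ ∞ fun y => y 0 * u y 0 + y 1 * u y 1 := by fun_prop
  refine (abs_le_vavg_pd (hm.of_le (by simp)) hav hx).trans ?_
  rw [← vavg_const_mul]
  refine vavg_le_of_column (contDiff_pd hm 2).continuous.abs (by fun_prop) fun t => ?_
  rw [pd_radial (hu.differentiable (by simp))]
  have := abs_add_le_of_le (abs_mul_le_of_le hx0 (hus 2 0 ![x 0, x 1, t]))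
    (abs_mul_le_of_le hx1 (hus 2 1 ![x 0, x 1, t]))
  simp
  linarith

theorem abs_vprim_radial_le (hu : ContDiff ℝ ∞ u) (hN : ∀ y j, |u y j| ≤ N)
    (hx0 : |x 0| ≤ 2 * R) (hx1 : |x 1| ≤ 2 * R) (hx : x ∈ slab) :
    |vprim (fun y => y 0 * u y 0 + y 1 * u y 1) x| ≤ 4 * R * N := by
  have hm : ContDiff ℝ ∞ fun y => y 0 * u y 0 + y 1 * u y 1 := by fun_prop
  refine (abs_vprim_le hm.continuous hx).trans ?_
  have : vavg (fun _ => 4 * R * N) x = 4 * R * N := by simp [vavg]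
  rw [← this]
  refine vavg_le_of_column hm.continuous.abs continuous_const fun t => ?_
  have := abs_add_le_of_le (abs_mul_le_of_le hx0 (hN ![x 0, x 1, t] 0))
    (abs_mul_le_of_le hx1 (hN ![x 0, x 1, t] 1))
  simp
  linarith

theorem abs_pd_vprim_radial_le (hu : ContDiff ℝ ∞ u) (hs : Continuous s)
    (hus : ∀ i j y, |pd i (fun y => u y j) y| ≤ s y) (hN : ∀ y j, |u y j| ≤ N) {i : Fin 3}
    (hi : i ≠ 2) (hx0 : |x 0| ≤ 2 * R) (hx1 : |x 1| ≤ 2 * R) (hx : x ∈ slab) :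
    |pd i (vprim fun y => y 0 * u y 0 + y 1 * u y 1) x| ≤ 2 * N + 4 * R * vavg s x := by
  have hm : ContDiff ℝ ∞ fun y => y 0 * u y 0 + y 1 * u y 1 := by fun_prop
  rw [pd_vprim hm hi]
  refine (abs_vprim_le (contDiff_pd hm i).continuous hx).trans ?_
  rw [← vavg_const_add_mul _ _ hs]
  refine vavg_le_of_column (contDiff_pd hm i).continuous.abs (by fun_prop) fun t => ?_
  rw [pd_radial (hu.differentiable (by simp))]
  have h1 : ∀ k, |(if i = k then 1 else 0 : ℝ)| ≤ 1 := fun k => by split_ifs <;> simp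
  have := abs_add_le_of_le
    (abs_add_le_of_le (abs_mul_le_of_le hx0 (hus i 0 ![x 0, x 1, t]))
      (abs_mul_le_of_le (hN ![x 0, x 1, t] 0) (h1 0)))
    (abs_add_le_of_le (abs_mul_le_of_le hx1 (hus i 1 ![x 0, x 1, t]))
      (abs_mul_le_of_le (hN ![x 0, x 1, t] 1) (h1 1)))
  simp at this ⊢
  linarith

theorem abs_energyRest_le {b : V3 → V3} {δ K : ℝ} {φ g : V3 → ℝ} (hδ : |δ| ≤ 1) (hR : 1 ≤ R)
    (hK : 0 < K) (hu : ContDiff ℝ ∞ u) (hb : ContDiff ℝ ∞ b) (hφ : IsCutoff K R φ g)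
    (hNu : ∀ y j, |u y j| ≤ N) (hNb : ∀ y j, |b y j| ≤ N) (hs : Continuous s)
    (hus : ∀ i j y, |pd i (fun y => u y j) y| ≤ s y)
    (hbs : ∀ i j y, |pd i (fun y => b y j) y| ≤ s y)
    (hm : vavg (fun y => y 0 * u y 0 + y 1 * u y 1) x = 0)
    (hn : vavg (fun y => y 0 * b y 0 + y 1 * b y 1) x = 0) (hx : x ∈ slab)
    (hxR : x 0 ^ 2 + x 1 ^ 2 ≤ 4 * R ^ 2) :
    |energyRest δ u b (fun y => cross3 (curl b y) (b y))
      (vprim fun y => y 0 * u y 0 + y 1 * u y 1) g x| ≤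
      100 * K * (N ^ 2 + N + 1) / R * (s x + vavg s x + s x * vavg s x) := by
  have hR0 : 0 < R := by linarith
  obtain ⟨hx0, hx1⟩ := abs_le_two_mul_of_sq_add_sq_le hR0.le hxR
  have hmle := abs_radial_le hu hs hus hx0 hx1 hx hm
  have hnle := abs_radial_le hb hs hbs hx0 hx1 hx hn
  have hW := abs_vprim_radial_le hu hNu hx0 hx1 hx
  have hW0 := abs_pd_vprim_radial_le hu hs hus hNu (i := 0) (by simp) hx0 hx1 hx
  have hW1 := abs_pd_vprim_radial_le hu hs hus hNu (i := 1) (by simp) hx0 hx1 hx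
  have hg := hφ.abs_g x
  have hg0 := hφ.abs_pd_g 0 x
  have hg1 := hφ.abs_pd_g 1 x
  have hs0 : 0 ≤ s x := (abs_nonneg _).trans (hus 0 0 x)
  have hv0 : 0 ≤ vavg s x := vavg_nonneg (fun y => (abs_nonneg _).trans (hus 0 0 y)) x
  have hN0 : 0 ≤ N := (abs_nonneg _).trans (hNu 0 0)
  have hU := hNu x
  have hB := hNb x
  have pu := fun i j => hus i j x
  have pb := fun i j => hbs i j x
  have hY : ∀ k, |cross3 (curl b x) (b x) k| ≤ 4 * (s x * N) := by
    have hc : ∀ k, |curl b x k| ≤ s x + s x := by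
      intro k
      fin_cases k <;> exact abs_sub_le_of_le (pb _ _) (pb _ _)
    intro k
    fin_cases k <;>
    exact (abs_sub_le_of_le (abs_mul_le_of_le (hc _) (hB _))
      (abs_mul_le_of_le (hc _) (hB _))).trans (le_of_eq (by ring))
  have hsq : ∀ j, |u x j ^ 2 + b x j ^ 2| ≤ N ^ 2 + N ^ 2 := fun j => by
    refine abs_add_le_of_le ?_ ?_
    · rw [abs_pow]
      gcongr
      apply hU
    · rw [abs_pow]
      gcongr
      apply hB
  have sum3 : ∀ {f : Fin 3 → ℝ} {c : ℝ}, (∀ j, |f j| ≤ c) → |∑ j, f j| ≤ 3 * c := by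
    intro f c hf
    refine (Finset.abs_sum_le_sum_abs _ _).trans ((Finset.sum_le_card_nsmul _ _ c fun j _ =>
      hf j).trans (le_of_eq ?_))
    simp
  have hQ : |(∑ j, (u x j ^ 2 + b x j ^ 2)) / 2| ≤ 3 * (N ^ 2 + N ^ 2) / 2 := by
    rw [abs_div, abs_two]
    exact div_le_div_of_nonneg_right (sum3 hsq) two_pos.le
  have T1 := abs_mul_le_of_le (abs_mul_le_of_le hQ hg) hmle
  have T2 := abs_mul_le_of_le (abs_mul_le_of_le
    (sum3 fun j => abs_mul_le_of_le (hU j) (hB j)) hg) hnle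
  have T34 := fun i => sum3 fun j => abs_add_le_of_le (abs_mul_le_of_le (hU j) (pu i j))
    (abs_mul_le_of_le (hB j) (pb i j))
  have T3 := abs_mul_le_of_le hg (abs_mul_le_of_le hx0 (T34 0))
  have T4 := abs_mul_le_of_le hg (abs_mul_le_of_le hx1 (T34 1))
  have T5 := abs_mul_le_of_le (abs_mul_le_of_le hδ hg)
    (abs_add_le_of_le (abs_mul_le_of_le hx0 (abs_sub_le_of_le
      (abs_mul_le_of_le (hY 1) (hB 2)) (abs_mul_le_of_le (hY 2) (hB 1))))
      (abs_mul_le_of_le hx1 (abs_sub_le_of_le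
      (abs_mul_le_of_le (hY 2) (hB 0)) (abs_mul_le_of_le (hY 0) (hB 2)))))
  have T6 := abs_mul_le_of_le hW (abs_add_le_of_le (abs_mul_le_of_le hg0 (pu 0 2))
    (abs_mul_le_of_le hg1 (pu 1 2)))
  have T7 := abs_mul_le_of_le hg (abs_add_le_of_le (abs_add_le_of_le
    (abs_mul_le_of_le hW0 (pu 0 2)) (abs_mul_le_of_le hW1 (pu 1 2)))
    (abs_mul_le_of_le hmle (pu 2 2)))
  have T8 := abs_mul_le_of_le (abs_mul_le_of_le hg hW) (sum3 fun j => abs_sub_le_of_le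
    (abs_mul_le_of_le (hU j) (pu j 2)) (abs_mul_le_of_le (hB j) (pb j 2)))
  refine (abs_add_le_of_le (abs_add_le_of_le (abs_add_le_of_le (abs_sub_le_of_le
    (abs_sub_le_of_le (abs_sub_le_of_le (abs_sub_le_of_le T1 T2) T3) T4) T5) T6) T7) T8).trans ?_
  set v := vavg s x
  calc _ = K / R * (24 * N ^ 2 * v + 24 * N * s x + 56 * N ^ 2 * s x + 12 * (s x * v))
        + K / R ^ 2 * (12 * N * s x) := by
        field_simp
        ring
    _ ≤ K / R * (24 * N ^ 2 * v + 24 * N * s x + 56 * N ^ 2 * s x + 12 * (s x * v))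
        + K / R * (12 * N * s x) := by
        gcongr
        nlinarith
    _ = K / R * (24 * N ^ 2 * v + 36 * N * s x + 56 * N ^ 2 * s x + 12 * (s x * v)) := by ring
    _ ≤ K / R * (100 * (N ^ 2 + N + 1) * (s x + v + s x * v)) := by
        gcongr
        have h1 : 0 ≤ s x * v := mul_nonneg hs0 hv0
        have h2 : 0 ≤ N * s x := mul_nonneg hN0 hs0
        have h3 : 0 ≤ N * v := mul_nonneg hN0 hv0
        have h4 : 0 ≤ N * (s x * v) := mul_nonneg hN0 h1
        have h5 : 0 ≤ N ^ 2 * s x := by positivity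
        have h6 : 0 ≤ N ^ 2 * v := by positivity
        have h7 : 0 ≤ N ^ 2 * (s x * v) := by positivity
        linarith
    _ = _ := by ring

end RestBound

section EnergyInequality

open Set Filter Topology
open scoped ContDiff

theorem sqrt_le_add_inv_mul {d τ : ℝ} (hd : 0 ≤ d) (hτ : 0 < τ) : √d ≤ τ + τ⁻¹ * d := by
  have h := Real.sq_sqrt hd
  have h2 : τ + τ⁻¹ * d - √d = τ⁻¹ * ((√d - τ / 2) ^ 2 + 3 / 4 * τ ^ 2) := by
    rw [← h, Real.sqrt_sq (Real.sqrt_nonneg d)]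
    field_simp
    ring
  have h3 : 0 ≤ τ⁻¹ * ((√d - τ / 2) ^ 2 + 3 / 4 * τ ^ 2) := by positivity
  linarith

theorem sqrt_mul_vavg_sqrt_le {d : V3 → ℝ} (hd : ∀ x, 0 ≤ d x) (hc : Continuous d) (x : V3) :
    √(d x) * vavg (fun y => √(d y)) x ≤ 1 / 2 * (d x + vavg d x) := by
  have h : √(d x) * vavg (fun y => √(d y)) x ≤ d x / 2 + 1 / 2 * vavg d x := by
    rw [← vavg_const_mul, ← vavg_const_add_mul _ _ hc]
    refine vavg_mono (by fun_prop) (by fun_prop) (fun y => ?_) x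
    nlinarith [Real.sq_sqrt (hd x), Real.sq_sqrt (hd y), sq_nonneg (√(d x) - √(d y))]
  linarith

theorem vavg_mul_of_column {w f : V3 → ℝ} (hw : ∀ (x : V3) s, w ![x 0, x 1, s] = w x) (x : V3) :
    vavg (fun y => w y * f y) x = w x * vavg f x := by
  simp only [vavg, hw, intervalIntegral.integral_const_mul]

theorem continuous_energyRest {δ : ℝ} {u b Y : V3 → V3} {W g : V3 → ℝ} (hu : ContDiff ℝ ∞ u)
    (hb : ContDiff ℝ ∞ b) (hY : ContDiff ℝ ∞ Y) (hW : ContDiff ℝ 1 W) (hg : ContDiff ℝ ∞ g) :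
    Continuous (energyRest δ u b Y W g) := by
  have c1 : ∀ i j, Continuous (pd i fun y => u y j) := fun i j =>
    (contDiff_pd (by fun_prop) i).continuous
  have c2 : ∀ i j, Continuous (pd i fun y => b y j) := fun i j =>
    (contDiff_pd (by fun_prop) i).continuous
  have c3 : ∀ i, Continuous (pd i g) := fun i => (contDiff_pd hg i).continuous
  have c4 : ∀ i, Continuous (pd i W) := fun i => continuous_pd hW i
  have c5 := hu.continuous
  have c6 := hb.continuous
  have c7 := hY.continuous
  have c8 := hW.continuous
  have c9 := hg.continuous
  unfold energyRest
  fun_prop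

/-- `φ_{2R} - φ_{R/2}` dominates the support of the gradient of `φ_R`. -/
theorem IsCutoff.annulus {K R : ℝ} {φ φ' g g' : V3 → ℝ}
    (h : IsCutoff K (2 * R) φ g) (h' : IsCutoff K (R / 2) φ' g') (x : V3) :
    0 ≤ φ x - φ' x ∧
      (R ^ 2 ≤ x 0 ^ 2 + x 1 ^ 2 ∧ x 0 ^ 2 + x 1 ^ 2 ≤ 4 * R ^ 2 → φ x - φ' x = 1) := by
  constructor
  · by_cases hx : R ^ 2 ≤ x 0 ^ 2 + x 1 ^ 2
    · rw [h'.eq_zero x (by linarith), sub_zero]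
      exact h.nonneg x
    · rw [h.eq_one x (by nlinarith)]
      linarith [h'.le_one x]
  · rintro ⟨h1, h2⟩
    rw [h'.eq_zero x (by linarith), h.eq_one x (by linarith), sub_zero]

theorem IsCutoff.le_of_two_mul_le {K R R' : ℝ} (hR : 0 ≤ R) (hRR' : 2 * R ≤ R')
    {φ φ' g g' : V3 → ℝ} (h : IsCutoff K R φ g) (h' : IsCutoff K R' φ' g') (x : V3) :
    φ x ≤ φ' x := by
  by_cases hx : x 0 ^ 2 + x 1 ^ 2 ≤ R' ^ 2
  · rw [h'.eq_one x hx]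
    exact h.le_one x
  · rw [h.eq_zero x (by nlinarith)]
    exact h'.nonneg x

theorem integral_weight_le {w d : V3 → ℝ} (hw : Continuous w) (hwc : HorizCompact w)
    (hcol : ∀ (x : V3) s, w ![x 0, x 1, s] = w x) (hd : Continuous d) (a c : ℝ) :
    ∫ x in slab, w x * (a + c * (d x + vavg d x)) =
      a * (∫ x in slab, w x) + 2 * c * ∫ x in slab, w x * d x := by
  have hv := continuous_vavg hd
  have h1 := integral_slab_vavg (f := fun x => w x * d x) (hw.mul hd) (hwc.mul_right d)
  rw [funext (vavg_mul_of_column hcol)] at h1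
  have i0 := hwc.integrableOn hw
  have i1 := (hwc.mul_right d).integrableOn (hw.mul hd)
  have i2 := (hwc.mul_right (vavg d)).integrableOn (hw.mul hv)
  calc _ = ∫ x in slab, (a * w x + (c * (w x * d x) + c * (w x * vavg d x))) := by
        congr 1
        ext x
        ring
    _ = _ := by
        have i3 : IntegrableOn (fun x => c * (w x * d x) + c * (w x * vavg d x)) slab :=
          (i1.const_mul c).add (i2.const_mul c)
        rw [integral_add (i0.const_mul a) i3, integral_add (i1.const_mul c) (i2.const_mul c),
          integral_const_mul, integral_const_mul, integral_const_mul, h1]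
        ring

variable {δ : ℝ} {u b : V3 → V3} {p : V3 → ℝ}

theorem abs_energyRest_le_weight {K R N τ : ℝ} {φ g w : V3 → ℝ} {x : V3} (hδ : |δ| ≤ 1)
    (hR : 1 ≤ R) (hK : 0 < K) (hτ : 0 < τ) (hu : ContDiff ℝ ∞ u) (hb : ContDiff ℝ ∞ b)
    (hφ : IsCutoff K R φ g) (hNu : ∀ y j, |u y j| ≤ N) (hNb : ∀ y j, |b y j| ≤ N)
    (hm : vavg (fun y => y 0 * u y 0 + y 1 * u y 1) x = 0)
    (hn : vavg (fun y => y 0 * b y 0 + y 1 * b y 1) x = 0) (hx : x ∈ slab) (hw0 : 0 ≤ w x)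
    (hw : R ^ 2 ≤ x 0 ^ 2 + x 1 ^ 2 ∧ x 0 ^ 2 + x 1 ^ 2 ≤ 4 * R ^ 2 → w x = 1) :
    |energyRest δ u b (fun y => cross3 (curl b y) (b y))
      (vprim fun y => y 0 * u y 0 + y 1 * u y 1) g x| ≤
      100 * K * (N ^ 2 + N + 1) / R *
        (w x * (2 * τ + (τ⁻¹ + 1) * (dens u b x + vavg (dens u b) x))) := by
  have hN0 : 0 ≤ N := (abs_nonneg _).trans (hNu 0 0)
  have hD := continuous_dens hu hb
  have hD0 := dens_nonneg u b
  have hv0 := vavg_nonneg hD0 x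
  by_cases hxR : R ^ 2 ≤ x 0 ^ 2 + x 1 ^ 2 ∧ x 0 ^ 2 + x 1 ^ 2 ≤ 4 * R ^ 2
  · refine (abs_energyRest_le hδ hR hK hu hb hφ hNu hNb hD.sqrt
      (fun i j y => (abs_pd_le_sqrt_dens u b i j y).1)
      (fun i j y => (abs_pd_le_sqrt_dens u b i j y).2) hm hn hx hxR.2).trans ?_
    rw [hw hxR, one_mul]
    have h1 := sqrt_le_add_inv_mul (hD0 x) hτ
    have h2 := vavg_mono hD.sqrt (by fun_prop) (fun y => sqrt_le_add_inv_mul (hD0 y) hτ) x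
    rw [vavg_const_add_mul _ _ hD] at h2
    have h3 := sqrt_mul_vavg_sqrt_le hD0 hD x
    refine mul_le_mul_of_nonneg_left ?_ (by positivity)
    linarith [hD0 x]
  · obtain ⟨h1, h2⟩ := hφ.support_g x hxR
    have : energyRest δ u b (fun y => cross3 (curl b y) (b y))
      (vprim fun y => y 0 * u y 0 + y 1 * u y 1) g x = 0 := by
      simp [energyRest, h1, h2]
    rw [this, abs_zero]
    have := hD0 x
    positivity

theorem IsMHD.energy_le {K N R lam : ℝ} {φ g : ℝ → V3 → ℝ} (h : IsMHD δ u b p)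
    (hδ : |δ| ≤ 1) (hu : ContDiff ℝ ∞ u) (hb : ContDiff ℝ ∞ b) (hp : ContDiff ℝ ∞ p)
    (hup : PeriodicZ u) (hbp : PeriodicZ b) (hpp : VertPeriodic p)
    (haxu : AxiSym (compR u)) (haxb : AxiSym (compR b)) (hNu : ∀ y j, |u y j| ≤ N)
    (hNb : ∀ y j, |b y j| ≤ N) (hK : 0 < K) (hφ : ∀ R > 0, IsCutoff K R (φ R) (g R))
    (hR : 1 ≤ R) (hlam : 0 < lam) :
    ∫ x in slab, φ R x * dens u b x ≤ 100 * K * (N ^ 2 + N + 1) * (512 * lam + 2 *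
      ((∫ x in slab, φ (2 * R) x * dens u b x) - ∫ x in slab, φ (R / 2) x * dens u b x) / lam
      + 2 * ((∫ x in slab, φ (2 * R) x * dens u b x) - ∫ x in slab, φ (R / 2) x * dens u b x)
      / R) := by
  have hR0 : 0 < R := by linarith
  have hN0 : 0 ≤ N := (abs_nonneg _).trans (hNu 0 0)
  have hφR := hφ R hR0
  have hφ2 := hφ (2 * R) (by linarith)
  have hφh := hφ (R / 2) (by linarith)
  have hD := continuous_dens hu hb
  have hm := vavg_radial_eq_zero hu h.2.2.1 hup haxu
  have hn := vavg_radial_eq_zero hb h.2.2.2 hbp haxb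
  have cm : ContDiff ℝ ∞ fun y : V3 => y 0 * u y 0 + y 1 * u y 1 := by fun_prop
  set Rest := energyRest δ u b (fun y => cross3 (curl b y) (b y))
      (vprim fun y => y 0 * u y 0 + y 1 * u y 1) (g R) with hRest
  have hid := h.integral_energy hu hb hp hup hbp hpp hφR rfl (contDiff_vprim cm)
    (pd_two_vprim cm) (fun x y => by simp [vprim])
    (fun x y => by simpa [vprim, vavg] using hm ![x, y, 0])
  have cRest : Continuous Rest := continuous_energyRest hu hb
    (contDiff_cross3 (contDiff_curl hb) hb) (contDiff_vprim cm) hφR.smooth_g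
  have hRest0 : HorizCompact Rest := horizCompact_of_eq_zero (R := R) fun x hx => by
    obtain ⟨h1, h2⟩ := hφR.support_g x fun h' => hx.not_ge h'.2
    simp [hRest, energyRest, h1, h2]
  have iφ : ∀ r > 0, IntegrableOn (fun x => φ r x * dens u b x) slab := fun r hr =>
    ((hφ r hr).horizCompact.1.mul_right _).integrableOn ((hφ r hr).smooth.continuous.mul hD)
  rw [integral_sub (hRest0.integrableOn cRest) (iφ R hR0), sub_eq_zero] at hid
  let w : V3 → ℝ := fun x => φ (2 * R) x - φ (R / 2) x
  have cw : Continuous w := hφ2.smooth.continuous.sub hφh.smooth.continuous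
  have hwc : HorizCompact w := by
    refine horizCompact_of_eq_zero (R := 2 * R) fun x hx => ?_
    simp only [w]
    rw [hφ2.eq_zero x hx.le, hφh.eq_zero x (by nlinarith), sub_zero]
  have hcol : ∀ (x : V3) s, w ![x 0, x 1, s] = w x := fun x s => by
    simp only [w, hφ2.column, hφh.column]
  have hw := hφ2.annulus hφh
  set τ := lam / R with hτ
  have hτ0 : 0 < τ := by positivity
  set C := 100 * K * (N ^ 2 + N + 1) with hC
  have hC0 : 0 ≤ C := by positivity
  have hbound : ‖∫ x in slab, Rest x‖ ≤ ∫ x in slab,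
      C / R * (w x * (2 * τ + (τ⁻¹ + 1) * (dens u b x + vavg (dens u b) x))) := by
    refine norm_integral_le_of_norm_le ?_ ((ae_restrict_iff' measurableSet_slab).2
      (ae_of_all _ fun x hx => abs_energyRest_le_weight hδ hR hK hτ0 hu hb hφR hNu hNb (hm x)
        (hn x) hx (hw x).1 (hw x).2))
    have cv := continuous_vavg hD
    exact ((hwc.mul_right _).integrableOn (by fun_prop)).const_mul _
  rw [integral_const_mul, integral_weight_le cw hwc hcol hD] at hbound
  have hA : ∫ x in slab, w x * dens u b x = (∫ x in slab, φ (2 * R) x * dens u b x) -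
      ∫ x in slab, φ (R / 2) x * dens u b x := by
    rw [← integral_sub (iφ _ (by linarith)) (iφ _ (by linarith))]
    simp only [w, sub_mul]
  have hw1 : ∫ x in slab, w x ≤ 256 * R ^ 2 := by
    have h1 : ∫ x in slab, w x ≤ ∫ x in slab, φ (2 * R) x :=
      integral_mono (hwc.integrableOn cw)
        (hφ2.horizCompact.1.integrableOn hφ2.smooth.continuous)
        fun x => by simp only [w]; linarith [hφh.nonneg x]
    linarith [hφ2.integral_le (by linarith)]
  rw [hA] at hbound
  set A := (∫ x in slab, φ (2 * R) x * dens u b x) - ∫ x in slab, φ (R / 2) x * dens u b x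
  rw [← hid]
  calc ∫ x in slab, Rest x ≤ _ := (le_abs_self _).trans hbound
    _ ≤ C / R * (2 * τ * (256 * R ^ 2) + 2 * (τ⁻¹ + 1) * A) := by
      refine mul_le_mul_of_nonneg_left ?_ (by positivity)
      have := mul_le_mul_of_nonneg_left hw1 (by positivity : 0 ≤ 2 * τ)
      linarith
    _ = _ := by
      rw [hτ]
      field_simp
      ring

end EnergyInequality

section Conclusion

open Set Filter Topology
open scoped ContDiff

theorem eq_zero_of_increment_bound {e : ℕ → ℝ} {C C₀ B : ℝ} (hC : 0 < C) (hB : 0 < B)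
    (hmono : Monotone e) (h0 : ∀ k, 0 ≤ e k) (hgrow : ∀ k, e k ≤ C₀ * B ^ k)
    (hinc : ∀ k, ∀ lam > 0, e k ≤ C * (512 * lam + 2 * (e (k + 1) - e k) / lam +
      2 * (e (k + 1) - e k) / (2 * 4 ^ k))) (k : ℕ) : e k = 0 := by
  by_contra hne
  have hk : 0 < e k := (h0 k).lt_of_ne' hne
  have hpos : ∀ n ≥ k, 0 < e n := fun n hn => hk.trans_le (hmono hn)
  let q : ℕ → ℝ := fun n => 2 * C * (2048 * C / e n + (1 / 4) ^ n)
  have key : ∀ n ≥ k, e n ≤ q n * (e (n + 1) - e n) := by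
    intro n hn
    have hn0 := hpos n hn
    have h := hinc n (e n / (1024 * C)) (by positivity)
    have h4 : (0 : ℝ) < 4 ^ n := by positivity
    have heq : C * (512 * (e n / (1024 * C)) + 2 * (e (n + 1) - e n) / (e n / (1024 * C)) +
        2 * (e (n + 1) - e n) / (2 * 4 ^ n)) = e n / 2 + q n / 2 * (e (n + 1) - e n) := by
      simp only [q, one_div, inv_pow]
      field_simp
      ring
    linarith
  have hda : ∀ n, 0 ≤ e (n + 1) - e n := fun n => sub_nonneg.2 (hmono n.le_succ)
  have htop : Tendsto e atTop atTop := by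
    let Q := 2 * C * (2048 * C / e k + 1)
    have hQ : 0 < Q := by positivity
    have hq : ∀ n ≥ k, q n ≤ Q := fun n hn => by
      have := hmono hn
      have h1 : (1 / 4 : ℝ) ^ n ≤ 1 := pow_le_one₀ (by norm_num) (by norm_num)
      simp only [q, Q]
      gcongr
    have hstep : ∀ n ≥ k, e k / Q ≤ e (n + 1) - e n := fun n hn => by
      rw [div_le_iff₀' hQ]
      exact (hmono hn).trans ((key n hn).trans (mul_le_mul_of_nonneg_right (hq n hn) (hda n)))
    have hlin : ∀ j : ℕ, j * (e k / Q) ≤ e (j + k) := by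
      intro j
      induction j with
      | zero => simpa using h0 k
      | succ j ih =>
        have := hstep (j + k) (by omega)
        rw [show j + 1 + k = j + k + 1 by ring]
        push_cast
        linarith
    rw [← tendsto_add_atTop_iff_nat k]
    exact tendsto_atTop_mono hlin (tendsto_natCast_atTop_atTop.atTop_mul_const (by positivity))
  have hq0 : Tendsto q atTop (𝓝 0) := by
    have h1 : Tendsto (fun n => 2048 * C / e n) atTop (𝓝 0) := htop.const_div_atTop _
    have h2 : Tendsto (fun n : ℕ => (1 / 4 : ℝ) ^ n) atTop (𝓝 0) :=
      tendsto_pow_atTop_nhds_zero_of_lt_one (by norm_num) (by norm_num)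
    simpa only [add_zero, mul_zero] using (h1.add h2).const_mul (2 * C)
  obtain ⟨n, hn⟩ := eventually_atTop.1
    ((hq0.eventually (gt_mem_nhds (by positivity : 0 < 1 / (2 * B)))).and (eventually_ge_atTop k))
  have hgeo : ∀ j : ℕ, (2 * B) ^ j * e n ≤ e (n + j) := by
    intro j
    induction j with
    | zero => simp
    | succ j ih =>
      obtain ⟨h1, h2⟩ := hn (n + j) (by omega)
      have h3 := (key _ h2).trans (mul_le_mul_of_nonneg_right h1.le (hda _))
      rw [one_div_mul_eq_div, le_div_iff₀ (by positivity)] at h3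
      have h4 := mul_le_mul_of_nonneg_left ih (by positivity : 0 ≤ 2 * B)
      rw [pow_succ, ← add_assoc]
      linarith [h0 (n + j)]
  have hen := hpos n (hn n le_rfl).2
  obtain ⟨j, hj⟩ := pow_unbounded_of_one_lt (C₀ * B ^ n / e n) one_lt_two
  rw [div_lt_iff₀ hen] at hj
  have h1 := (hgeo j).trans (hgrow (n + j))
  rw [mul_pow, pow_add] at h1
  have h2 := mul_lt_mul_of_pos_right hj (pow_pos hB j)
  linarith

theorem VertPeriodic.exists_mem_slab {f : V3 → ℝ} (hf : VertPeriodic f) (x : V3) :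
    ∃ t, ![x 0, x 1, t] ∈ slab ∧ f x = f ![x 0, x 1, t] := by
  have hper : Function.Periodic (fun t => f ![x 0, x 1, t]) 1 := fun t => by
    show f ![x 0, x 1, t + 1] = f ![x 0, x 1, t]
    rw [← hf ![x 0, x 1, t]]
    congr 1
    ext i
    fin_cases i <;> simp
  obtain ⟨t, ht, h⟩ := hper.exists_mem_Ico₀ one_pos (x 2)
  exact ⟨t, ⟨by simpa using ht.1, by simpa using ht.2.le⟩, by rw [← h, vec3_eta]⟩

theorem slab_subset_closure_interior : slab ⊆ closure (interior slab) := by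
  have hconv : Convex ℝ slab := by
    have : slab = (fun x : V3 => x 2) ⁻¹' Icc 0 1 := rfl
    rw [this]
    exact (convex_Icc (0 : ℝ) 1).linear_preimage (LinearMap.proj (R := ℝ) (φ := fun _ => ℝ) 2)
  have hopen : IsOpen ((fun x : V3 => x 2) ⁻¹' Ioo 0 1) := isOpen_Ioo.preimage (by fun_prop)
  have hsub : (fun x : V3 => x 2) ⁻¹' Ioo 0 1 ⊆ slab := fun x hx => ⟨hx.1.le, hx.2.le⟩
  have hmem : (fun _ => 1 / 2 : V3) ∈ (fun x : V3 => x 2) ⁻¹' Ioo 0 1 := by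
    norm_num [mem_preimage]
  have hint : (interior slab).Nonempty := ⟨_, interior_maximal hsub hopen hmem⟩
  rw [hconv.closure_interior_eq_closure_of_nonempty_interior hint]
  exact subset_closure

variable {δ : ℝ} {u b : V3 → V3} {p : V3 → ℝ}

theorem IsCutoff.integral_mul_le_cylSet {K R : ℝ} {φ g d : V3 → ℝ} (hR : 0 ≤ R)
    (h : IsCutoff K R φ g) (hd : Continuous d) (hd0 : ∀ x, 0 ≤ d x) :
    ∫ x in slab, φ x * d x ≤ ∫ x in cylSet (2 * R), d x := by
  have hcyl : ∀ x : V3, nr x ≤ 2 * R ↔ x 0 ^ 2 + x 1 ^ 2 ≤ 4 * R ^ 2 := fun x => by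
    rw [nr, Real.sqrt_le_left (by positivity)]
    ring_nf
  have hmeas : MeasurableSet (cylSet (2 * R)) := by
    have : Measurable nr := by
      unfold nr
      fun_prop
    exact measurableSet_slab.inter (this measurableSet_Iic)
  have hsub : cylSet (2 * R) ⊆ box (2 * R) := fun x hx => by
    obtain ⟨h1, h2⟩ := abs_le_two_mul_of_sq_add_sq_le hR ((hcyl x).1 hx.2)
    exact mem_box.2 ⟨h1, h2, hx.1⟩
  have hint : ∀ f : V3 → ℝ, Continuous f → IntegrableOn f (cylSet (2 * R)) := fun f hf =>
    (hf.continuousOn.integrableOn_compact isCompact_Icc).mono_set hsub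
  rw [setIntegral_eq_of_subset_of_forall_sdiff_eq_zero (f := fun x => φ x * d x)
    measurableSet_slab (fun x (hx : x ∈ cylSet (2 * R)) => hx.1)]
  · exact setIntegral_mono_on (hint _ (h.smooth.continuous.mul hd)) (hint _ hd) hmeas
      fun x _ => mul_le_of_le_one_left (hd0 x) (h.le_one x)
  · intro x hx
    have : ¬ x 0 ^ 2 + x 1 ^ 2 ≤ 4 * R ^ 2 := fun h' => hx.2 ⟨hx.1, (hcyl x).2 h'⟩
    rw [h.eq_zero x (not_le.1 this).le, zero_mul]

theorem eq_zero_of_integral_cutoff_eq_zero {K : ℝ} {φ g : ℝ → V3 → ℝ} {d : V3 → ℝ}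
    (hφ : ∀ R > 0, IsCutoff K R (φ R) (g R)) (hd : Continuous d) (hd0 : ∀ x, 0 ≤ d x)
    (hper : VertPeriodic d) (h : ∀ k : ℕ, ∫ x in slab, φ (4 ^ k) x * d x = 0) (x : V3) :
    d x = 0 := by
  obtain ⟨t, ht, hx⟩ := hper.exists_mem_slab x
  rw [hx]
  obtain ⟨k, hk⟩ := pow_unbounded_of_one_lt (x 0 ^ 2 + x 1 ^ 2) (by norm_num : (1 : ℝ) < 4)
  have hφk := hφ (4 ^ k) (by positivity)
  have hc : Continuous fun y => φ (4 ^ k) y * d y := hφk.smooth.continuous.mul hd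
  have hae := (setIntegral_eq_zero_iff_of_nonneg_ae
    (Eventually.of_forall fun y => mul_nonneg (hφk.nonneg y) (hd0 y))
    ((hφk.horizCompact.1.mul_right d).integrableOn hc)).1 (h k)
  have h0 := Measure.eqOn_of_ae_eq hae hc.continuousOn continuousOn_const
    slab_subset_closure_interior ht
  have h1 : φ (4 ^ k) ![x 0, x 1, t] = 1 := by
    refine hφk.eq_one _ ?_
    have : (1 : ℝ) ≤ 4 ^ k := one_le_pow₀ (by norm_num)
    simp only [Matrix.cons_val_zero, Matrix.cons_val_one]
    nlinarith
  simpa [h1] using h0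

theorem IsMHD.dens_eq_zero (h : IsMHD δ u b p)
    (hδ : |δ| ≤ 1) (hu : ContDiff ℝ ∞ u) (hb : ContDiff ℝ ∞ b) (hp : ContDiff ℝ ∞ p)
    (hubd : Bounded3 u) (hbbd : Bounded3 b) (hup : PeriodicZ u) (hbp : PeriodicZ b)
    (hgrow : DirichletGrowth u b) (haxu : AxiSym (compR u)) (haxb : AxiSym (compR b)) (x : V3) :
    dens u b x = 0 := by
  have hpp := h.vertPeriodic_pressure hu hb hp hup hbp hubd hbbd
  obtain ⟨M, hM⟩ := hubd
  obtain ⟨M', hM'⟩ := hbbd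
  have hNu : ∀ y j, |u y j| ≤ max M M' := fun y j =>
    (norm_le_pi_norm (u y) j).trans ((hM y).trans (le_max_left _ _))
  have hNb : ∀ y j, |b y j| ≤ max M M' := fun y j =>
    (norm_le_pi_norm (b y) j).trans ((hM' y).trans (le_max_right _ _))
  have hN : 0 ≤ max M M' := (abs_nonneg _).trans (hNu 0 0)
  obtain ⟨K, hK, φ, g, hφ⟩ := exists_isCutoff
  obtain ⟨A, hA, α, hα, hgrow⟩ := hgrow
  have hD := continuous_dens hu hb
  have hD0 := dens_nonneg u b
  have hper : VertPeriodic (dens u b) := fun y => by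
    simp only [dens, gradSq, ((hup.vertPeriodic _).pd _) y, ((hbp.vertPeriodic _).pd _) y]
  have hle : ∀ R > 0, ∀ R', 2 * R ≤ R' →
      ∫ x in slab, φ R x * dens u b x ≤ ∫ x in slab, φ R' x * dens u b x := by
    intro R hR R' hRR'
    have hφR := hφ R hR
    have hφR' := hφ R' (by linarith)
    exact integral_mono
      ((hφR.horizCompact.1.mul_right _).integrableOn (hφR.smooth.continuous.mul hD))
      ((hφR'.horizCompact.1.mul_right _).integrableOn (hφR'.smooth.continuous.mul hD))
      fun y => mul_le_mul_of_nonneg_right (hφR.le_of_two_mul_le hR.le hRR' hφR' y) (hD0 y)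
  have h4 : ∀ k : ℕ, (1 : ℝ) ≤ 4 ^ k := fun k => one_le_pow₀ (by norm_num)
  refine eq_zero_of_integral_cutoff_eq_zero hφ hD hD0 hper
    (eq_zero_of_increment_bound (e := fun k : ℕ => ∫ x in slab, φ (4 ^ k) x * dens u b x)
      (C := 100 * K * (max M M' ^ 2 + max M M' + 1)) (C₀ := A * 2 ^ α) (B := 4 ^ α)
      (by positivity) (by positivity) (monotone_nat_of_le_succ fun k => ?_) (fun k => ?_)
      (fun k => ?_) (fun k lam hlam => ?_)) x
  · refine hle _ (by positivity) _ ?_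
    rw [pow_succ]
    linarith [h4 k]
  · exact integral_nonneg fun y => mul_nonneg ((hφ _ (by positivity)).nonneg y) (hD0 y)
  · refine ((hφ (4 ^ k) (by positivity)).integral_mul_le_cylSet (by positivity) hD hD0).trans
      ((hgrow (2 * 4 ^ k) (by linarith [h4 k])).trans (le_of_eq ?_))
    rw [Real.mul_rpow (by norm_num) (by positivity), ← Real.rpow_natCast_mul (by norm_num),
      mul_comm (k : ℝ), Real.rpow_mul_natCast (by norm_num), mul_assoc]
  · have h1 := h.energy_le hδ hu hb hp hup hbp hpp haxu haxb hNu hNb hK hφ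
      (R := 2 * 4 ^ k) (by linarith [h4 k]) hlam
    rw [show (2 : ℝ) * (2 * 4 ^ k) = 4 ^ (k + 1) by ring,
      show (2 : ℝ) * 4 ^ k / 2 = 4 ^ k by ring] at h1
    exact (hle (4 ^ k) (by positivity) _ le_rfl).trans h1

theorem eq_vertical_of_gradSq_eq_zero {v : V3 → V3} (hv : ContDiff ℝ ∞ v)
    (h : ∀ x, gradSq v x = 0) (hax : AxiSym (compR v)) : ∃ c : ℝ, ∀ x, v x = ![0, 0, c] := by
  have hpd : ∀ i j x, pd i (fun y => v y j) x = 0 := fun i j x => by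
    have := sq_pd_le_gradSq v i j x
    rw [h] at this
    exact pow_eq_zero_iff two_ne_zero |>.1 (le_antisymm this (sq_nonneg _))
  have hconst : ∀ j x, v x j = v 0 j := fun j x =>
    eq_const_of_pd_eq_zero (f := fun y => v y j) ((contDiff_pi.1 hv j).differentiable (by simp))
      (fun i y => hpd i j y) x 0
  have h1 := hax 1 0 Real.pi 0
  have h2 := hax 1 0 (Real.pi / 2) 0
  simp only [compR, hconst 0 (cylPt _ _ _), hconst 1 (cylPt _ _ _), Real.cos_zero, Real.sin_zero,
    Real.cos_pi, Real.sin_pi, Real.cos_pi_div_two, Real.sin_pi_div_two] at h1 h2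
  refine ⟨v 0 2, fun x => ?_⟩
  ext i
  rw [hconst]
  fin_cases i
  · simp; linarith
  · simp; linarith
  · simp

end Conclusion

/-- Liouville theorem for MHD/Hall–MHD in the slab under axisymmetry
of the radial components `u^r, b^r`. -/
theorem liouville_radial_axisym (δ : ℝ) (hδ : δ ∈ Set.Icc (0:ℝ) 1)
    (u b : V3 → V3) (p : V3 → ℝ)
    (hu : ContDiff ℝ (⊤ : ℕ∞) u) (hb : ContDiff ℝ (⊤ : ℕ∞) b) (hp : ContDiff ℝ (⊤ : ℕ∞) p)
    (hubd : Bounded3 u) (hbbd : Bounded3 b)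
    (hup : PeriodicZ u) (hbp : PeriodicZ b)
    (hsol : IsMHD δ u b p)
    (hgrow : DirichletGrowth u b)
    (haxu : AxiSym (compR u)) (haxb : AxiSym (compR b)) :
    ∃ c₁ c₂ : ℝ, (∀ x, u x = ![0, 0, c₁]) ∧ (∀ x, b x = ![0, 0, c₂]) := by
  have hδ' : |δ| ≤ 1 := by
    rw [abs_of_nonneg hδ.1]
    exact hδ.2
  have hsum : ∀ x, gradSq u x + gradSq b x = 0 :=
    hsol.dens_eq_zero hδ' hu hb hp hubd hbbd hup hbp hgrow haxu haxb
  obtain ⟨c₁, h₁⟩ := eq_vertical_of_gradSq_eq_zero hu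
    (fun x => by linarith [hsum x, gradSq_nonneg u x, gradSq_nonneg b x]) haxu
  obtain ⟨c₂, h₂⟩ := eq_vertical_of_gradSq_eq_zero hb
    (fun x => by linarith [hsum x, gradSq_nonneg u x, gradSq_nonneg b x]) haxb
  exact ⟨c₁, c₂, h₁, h₂⟩
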